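/- arXiv:1804.01372 — 6 statements merged into one kernel-verified Lean document; each statement's English description precedes it below -/
import Mathlib

section
/- Let X be a real Banach space, let (e_j)_{j∈ℕ} be a sequence in X with ‖e_j‖ = 1 for all j, let Λ₀ ⊆ ℕ be an infinite set, let m, n ≥ 1 be natural numbers, let x₁*, …, x_n* be continuous linear functionals on X, and let η > 0. Then there exists a finite set F ⊆ Λ₀ with |F| = 2m such that for every choice of signs ε_k ∈ {−1, +1} (k ∈ F) satisfying ∑_{k∈F} ε_k = 0, one has |x_j*(∑_{k∈F} ε_k e_k)| ≤ η for all 1 ≤ j ≤ n. -/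
/-- A bounded sequence in a proper metric space has, inside any infinite index set, finite sets of
indices of any prescribed size whose terms all lie in one ball of prescribed radius. -/
theorem exists_finset_card_eq_forall_dist_lt {E : Type*} [PseudoMetricSpace E] [ProperSpace E]
    {v : ℕ → E} (hv : Bornology.IsBounded (Set.range v)) {S : Set ℕ} (hS : S.Infinite) (N : ℕ)
    {δ : ℝ} (hδ : 0 < δ) :
    ∃ (F : Finset ℕ) (c : E), ↑F ⊆ S ∧ F.card = N ∧ ∀ k ∈ F, dist (v k) c < δ := by
  obtain ⟨c, -, φ, hφ, hlim⟩ :=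
    tendsto_subseq_of_bounded hv (fun i => Set.mem_range_self (hS.natEmbedding S i : ℕ))
  obtain ⟨M, hM⟩ := Metric.tendsto_atTop.1 hlim δ hδ
  have hinj : Function.Injective fun i => (hS.natEmbedding S (φ i) : ℕ) :=
    Subtype.val_injective.comp ((hS.natEmbedding S).injective.comp hφ.injective)
  refine ⟨(Finset.Ico M (M + N)).image fun i => (hS.natEmbedding S (φ i) : ℕ), c, ?_, ?_, ?_⟩
  · intro k hk
    obtain ⟨i, -, rfl⟩ := Finset.mem_image.1 (Finset.mem_coe.1 hk)
    exact Subtype.property _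
  · simp [Finset.card_image_of_injective _ hinj]
  · intro k hk
    obtain ⟨i, hi, rfl⟩ := Finset.mem_image.1 hk
    exact hM i (Finset.mem_Ico.1 hi).1

/-- A balanced signed sum of reals within `δ` of a common point is at most `card * δ`. -/
theorem abs_sum_sign_mul_le {ι : Type*} {F : Finset ι} {ε a : ι → ℝ} {c δ : ℝ}
    (hε : ∀ k ∈ F, ε k = 1 ∨ ε k = -1) (hsum : ∑ k ∈ F, ε k = 0)
    (ha : ∀ k ∈ F, |a k - c| ≤ δ) : |∑ k ∈ F, ε k * a k| ≤ F.card * δ := by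
  have hcenter : ∑ k ∈ F, ε k * a k = ∑ k ∈ F, ε k * (a k - c) := by
    simp [mul_sub, Finset.sum_sub_distrib, ← Finset.sum_mul, hsum]
  rw [hcenter, ← nsmul_eq_mul]
  refine (Finset.abs_sum_le_sum_abs _ _).trans (Finset.sum_le_card_nsmul _ _ _ fun k hk => ?_)
  rcases hε k hk with h | h <;> simpa [h, abs_mul, abs_sub_comm] using ha k hk


/-- **Subspace annihilation lemma (Lemma 3.1).**
Let `X` be a real Banach space, `(e j)` a normalized sequence in `X`, `Λ₀ ⊆ ℕ` infinite,
`m, n ≥ 1`, `x₁*, …, x_n*` continuous linear functionals on `X` and `η > 0`.  Then there is a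
finite set `F ⊆ Λ₀` with `|F| = 2m` such that for every choice of signs `ε k ∈ {−1, +1}` (`k ∈ F`)
with `∑_{k ∈ F} ε k = 0` one has `|x_j*(∑_{k ∈ F} ε k • e k)| ≤ η` for all `j`. -/
theorem subspace_annihilation
    (X : Type*) [NormedAddCommGroup X] [NormedSpace ℝ X] [CompleteSpace X]
    (e : ℕ → X) (he : ∀ j, ‖e j‖ = 1)
    (Λ₀ : Set ℕ) (hΛ₀ : Λ₀.Infinite)
    (m n : ℕ) (hm : 1 ≤ m) (hn : 1 ≤ n)
    (x : Fin n → X →L[ℝ] ℝ)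
    (η : ℝ) (hη : 0 < η) :
    ∃ F : Finset ℕ, ↑F ⊆ Λ₀ ∧ F.card = 2 * m ∧
      ∀ ε : ℕ → ℝ, (∀ k ∈ F, ε k = 1 ∨ ε k = -1) → (∑ k ∈ F, ε k) = 0 →
        ∀ j : Fin n, |x j (∑ k ∈ F, ε k • e k)| ≤ η := by
  have hbdd : Bornology.IsBounded (Set.range fun k j => x j (e k)) := by
    refine Bornology.forall_isBounded_image_eval_iff.1 fun j => ?_
    refine isBounded_iff_forall_norm_le.2 ⟨‖x j‖, ?_⟩
    rintro _ ⟨_, ⟨k, rfl⟩, rfl⟩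
    simpa [he k] using (x j).le_opNorm (e k)
  have hm' : (0 : ℝ) < m := by exact_mod_cast hm
  obtain ⟨F, c, hFS, hcard, hF⟩ := exists_finset_card_eq_forall_dist_lt hbdd hΛ₀ (2 * m)
    (show 0 < η / (2 * m) by positivity)
  refine ⟨F, hFS, hcard, fun ε hε hsum j => ?_⟩
  have hle := abs_sum_sign_mul_le (a := fun k => x j (e k)) (c := c j) hε hsum fun k hk =>
    (dist_le_pi_dist (fun j => x j (e k)) c j).trans (hF k hk).le
  rw [hcard] at hle
  push_cast at hle
  rw [mul_div_cancel₀ _ (by positivity)] at hle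
  simpa [map_sum] using hle
end

section
/- For every bounded linear operator T : ℓ∞ → ℓ∞ there exist bounded linear operators M, N : ℓ∞ → ℓ∞ with ‖M‖·‖N‖ ≤ 48 such that either N ∘ T ∘ M = Id or N ∘ (Id − T) ∘ M = Id, where Id denotes the identity operator on ℓ∞. -/
open scoped ENNReal

/-- Rosenthal's disjointification lemma for a uniformly bounded family of monotone set functions
that are superadditive on disjoint sets. -/
theorem rosenthal_disjointification {v : ℕ → Set ℕ → ℝ} {ε : ℝ} (hε : 0 < ε)
    (mono : ∀ i S S', S ⊆ S' → v i S ≤ v i S')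
    (superadd : ∀ i S S', Disjoint S S' → v i S + v i S' ≤ v i (S ∪ S'))
    (n : ℕ) (A : Set ℕ) (hA : A.Infinite) (bound : ∀ i ∈ A, v i A ≤ n * ε) :
    ∃ B ⊆ A, B.Infinite ∧ ∀ i ∈ B, v i (B \ {i}) ≤ ε := by
  induction n generalizing A with
  | zero =>
    refine ⟨A, subset_rfl, hA, fun i hi => ?_⟩
    have h₁ := bound i hi
    have h₂ := mono i _ _ (Set.sdiff_subset (s := A) (t := {i}))
    simp only [Nat.cast_zero, zero_mul] at h₁
    linarith
  | succ n ih =>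
    let f : ℕ → ℕ := fun k => hA.natEmbedding A k
    have hf : Function.Injective f := fun a b hab =>
      (hA.natEmbedding A).injective (Subtype.ext hab)
    have hfA : ∀ k, f k ∈ A := fun k => (hA.natEmbedding A k).2
    let P : ℕ → Set ℕ := fun p => Set.range fun q => f (Nat.pair p q)
    have hPA : ∀ p, P p ⊆ A := by
      rintro p _ ⟨q, rfl⟩
      exact hfA _
    by_cases h : ∃ p, ∀ i ∈ P p, v i (P p \ {i}) ≤ ε
    · obtain ⟨p, hp⟩ := h
      refine ⟨P p, hPA p, Set.infinite_range_of_injective fun a b hab => ?_, hp⟩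
      exact (Nat.pair_eq_pair.1 (hf hab)).2
    · push Not at h
      choose k hkP hk using h
      choose q hq using hkP
      have hkA : Set.range k ⊆ A := by
        rintro _ ⟨p, rfl⟩
        rw [← hq]
        exact hfA _
      have hinj : Function.Injective k := fun a b hab => by
        rw [← hq, ← hq] at hab
        exact (Nat.pair_eq_pair.1 (hf hab)).1
      obtain ⟨B, hBA, hB⟩ := ih (Set.range k) (Set.infinite_range_of_injective hinj) (by
        rintro _ ⟨p, rfl⟩
        have hdisj : Disjoint (Set.range k) (P p \ {k p}) := by
          rw [Set.disjoint_left]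
          rintro _ ⟨p', rfl⟩ ⟨⟨r, hr⟩, hne⟩
          refine hne ?_
          have hr' : f (Nat.pair p r) = f (Nat.pair p' (q p')) := hr.trans (hq p').symm
          rw [(Nat.pair_eq_pair.1 (hf hr')).1]
          rfl
        have h₁ := superadd (k p) _ _ hdisj
        have h₂ := mono (k p) _ _
          (Set.union_subset hkA ((Set.sdiff_subset (s := P p) (t := {k p})).trans (hPA p)))
        have h₃ := bound (k p) (hkA ⟨p, rfl⟩)
        have h₄ := hk p
        push_cast at h₃
        linarith)
      exact ⟨B, hBA.trans hkA, hB⟩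

namespace LInfty

/-- The space `ℓ∞` of bounded real sequences. -/
local notation "ℓ∞" => lp (fun _ : ℕ => ℝ) ∞

theorem sub_apply (x y : ℓ∞) (n : ℕ) : (x - y) n = x n - y n := rfl

theorem smul_apply (r : ℝ) (x : ℓ∞) (n : ℕ) : (r • x) n = r * x n := rfl

theorem abs_apply_le (x : ℓ∞) (n : ℕ) : |x n| ≤ ‖x‖ :=
  lp.norm_apply_le_norm ENNReal.top_ne_zero x n

theorem norm_le {x : ℓ∞} {C : ℝ} (hC : 0 ≤ C) (h : ∀ n, |x n| ≤ C) : ‖x‖ ≤ C :=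
  lp.norm_le_of_forall_le hC h

/-- The weighted composition operator `x ↦ (c n * x (f n))ₙ` on `ℓ∞`. -/
noncomputable def weightedComp (f : ℕ → ℕ) (c : ℕ → ℝ) (C : ℝ) (hc : ∀ n, |c n| ≤ C) :
    ℓ∞ →L[ℝ] ℓ∞ :=
  have bound (x : ℓ∞) (n : ℕ) : |c n * x (f n)| ≤ C * ‖x‖ := by
    rw [abs_mul]
    exact mul_le_mul (hc n) (abs_apply_le x _) (abs_nonneg _) ((abs_nonneg _).trans (hc n))
  LinearMap.mkContinuous
    { toFun := fun x => ⟨fun n => c n * x (f n), memℓp_infty ⟨C * ‖x‖, by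
        rintro _ ⟨n, rfl⟩
        exact bound x n⟩⟩
      map_add' := fun x y => by
        ext n
        exact mul_add _ _ _
      map_smul' := fun r x => by
        ext n
        exact mul_left_comm _ _ _ }
    C fun x => norm_le ((abs_nonneg _).trans (bound x 0)) (bound x)

section weightedComp

variable {f : ℕ → ℕ} {c : ℕ → ℝ} {C : ℝ} {hc : ∀ n, |c n| ≤ C}

@[simp]
theorem weightedComp_apply (x : ℓ∞) (n : ℕ) : weightedComp f c C hc x n = c n * x (f n) := rfl

theorem norm_weightedComp_le : ‖weightedComp f c C hc‖ ≤ C := by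
  unfold weightedComp
  exact LinearMap.mkContinuous_norm_le _ ((abs_nonneg _).trans (hc 0)) _

end weightedComp

/-- The values `T x i` for `x` in the unit ball of `ℓ∞` supported in `S`. -/
def rowValues (T : ℓ∞ →L[ℝ] ℓ∞) (i : ℕ) (S : Set ℕ) : Set ℝ :=
  (fun x : ℓ∞ => T x i) '' {x | ‖x‖ ≤ 1 ∧ ∀ j ∉ S, x j = 0}

/-- The variation over `S` of the `i`-th row of `T`, a finitely additive measure on `ℕ`. -/
noncomputable def rowVariation (T : ℓ∞ →L[ℝ] ℓ∞) (i : ℕ) (S : Set ℕ) : ℝ :=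
  sSup (rowValues T i S)

variable (T : lp (fun _ : ℕ => ℝ) ∞ →L[ℝ] lp (fun _ : ℕ => ℝ) ∞) (i : ℕ) {S S' : Set ℕ}

theorem rowValues_nonempty : (rowValues T i S).Nonempty :=
  ⟨_, 0, by simp, rfl⟩

theorem le_opNorm_of_mem_rowValues {a : ℝ} (ha : a ∈ rowValues T i S) : a ≤ ‖T‖ := by
  obtain ⟨x, ⟨hx, -⟩, rfl⟩ := ha
  exact (le_abs_self _).trans ((abs_apply_le _ i).trans (T.unit_le_opNorm x hx))

theorem bddAbove_rowValues : BddAbove (rowValues T i S) :=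
  ⟨‖T‖, fun _ => le_opNorm_of_mem_rowValues T i⟩

theorem rowVariation_le_opNorm : rowVariation T i S ≤ ‖T‖ :=
  csSup_le (rowValues_nonempty T i) fun _ => le_opNorm_of_mem_rowValues T i

theorem rowVariation_mono (h : S ⊆ S') : rowVariation T i S ≤ rowVariation T i S' :=
  csSup_le_csSup (bddAbove_rowValues T i) (rowValues_nonempty T i)
    (Set.image_mono fun _ hx => ⟨hx.1, fun j hj => hx.2 j fun hS => hj (h hS)⟩)

theorem rowVariation_add_le (h : Disjoint S S') :
    rowVariation T i S + rowVariation T i S' ≤ rowVariation T i (S ∪ S') := by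
  rw [← le_sub_iff_add_le]
  refine csSup_le (rowValues_nonempty T i) ?_
  rintro _ ⟨x, ⟨hx, hxS⟩, rfl⟩
  rw [le_sub_comm]
  refine csSup_le (rowValues_nonempty T i) ?_
  rintro _ ⟨y, ⟨hy, hyS⟩, rfl⟩
  rw [le_sub_iff_add_le]
  refine le_csSup (bddAbove_rowValues T i) ⟨x + y, ⟨norm_le zero_le_one fun j => ?_, ?_⟩, ?_⟩
  · by_cases hj : j ∈ S
    · simpa [hyS j (Set.disjoint_left.1 h hj)] using (abs_apply_le x j).trans hx
    · simpa [hxS j hj] using (abs_apply_le y j).trans hy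
  · intro j hj
    rw [Set.mem_union, not_or] at hj
    simp [hxS j hj.1, hyS j hj.2]
  · simp [add_comm]

theorem abs_apply_le_rowVariation_mul_norm {x : ℓ∞} (hx : ∀ j ∉ S, x j = 0) :
    |T x i| ≤ rowVariation T i S * ‖x‖ := by
  rcases eq_or_ne x 0 with rfl | hx₀
  · simp
  have hpos : 0 < ‖x‖ := norm_pos_iff.2 hx₀
  have key (r : ℝ) (hr : |r| = ‖x‖⁻¹) : r * T x i ≤ rowVariation T i S := by
    refine le_csSup (bddAbove_rowValues T i) ⟨r • x, ⟨?_, fun j hj => ?_⟩, ?_⟩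
    · rw [norm_smul, Real.norm_eq_abs, hr, inv_mul_cancel₀ hpos.ne']
    · simp [hx j hj]
    · simp
  have h₁ := key ‖x‖⁻¹ (abs_of_pos (inv_pos.2 hpos))
  have h₂ := key (-‖x‖⁻¹) (by rw [abs_neg, abs_of_pos (inv_pos.2 hpos)])
  rw [neg_mul, ← mul_neg] at h₂
  rw [← div_le_iff₀ hpos, div_eq_inv_mul]
  rcases abs_choice (T x i) with h | h <;> rwa [h]

/-- The identity of `ℓ∞` factors through every operator with large diagonal. -/
theorem exists_factorization_of_large_diagonal {A : Set ℕ} (hA : A.Infinite)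
    (hdiag : ∀ n ∈ A, 1 / 2 ≤ T (lp.single ∞ n (1 : ℝ)) n) :
    ∃ M N : ℓ∞ →L[ℝ] ℓ∞, ‖M‖ * ‖N‖ ≤ 4 ∧ N ∘L T ∘L M = ContinuousLinearMap.id ℝ ℓ∞ := by
  obtain ⟨n₀, hn₀⟩ := exists_nat_ge (‖T‖ / (1 / 4))
  rw [div_le_iff₀ (by norm_num)] at hn₀
  obtain ⟨B, hBA, hB, hsmall⟩ := rosenthal_disjointification (v := rowVariation T)
    (by norm_num : (0 : ℝ) < 1 / 4) (fun i _ _ => rowVariation_mono T i)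
    (fun i _ _ => rowVariation_add_le T i) n₀ A hA
    (fun i _ => (rowVariation_le_opNorm T i).trans hn₀)
  let b : ℕ → ℕ := fun k => hB.natEmbedding B k
  have hb : Function.Injective b := fun k l hkl =>
    (hB.natEmbedding B).injective (Subtype.ext hkl)
  have hbB : ∀ k, b k ∈ B := fun k => (hB.natEmbedding B k).2
  let d : ℕ → ℝ := fun k => T (lp.single ∞ (b k) (1 : ℝ)) (b k)
  have hd : ∀ k, 1 / 2 ≤ d k := fun k => hdiag _ (hBA (hbB k))
  have hd_inv : ∀ k, |(d k)⁻¹| ≤ 2 := fun k => by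
    have hk := hd k
    rw [abs_of_nonneg (by positivity), inv_le_comm₀ (by linarith) two_pos]
    linarith
  let M : ℓ∞ →L[ℝ] ℓ∞ := weightedComp (Function.invFun b) (B.indicator 1) 1 fun m => by
    by_cases hm : m ∈ B <;> simp [hm]
  let Q : ℓ∞ →L[ℝ] ℓ∞ := weightedComp b (fun k => (d k)⁻¹) 2 hd_inv
  have hM : ‖M‖ ≤ 1 := norm_weightedComp_le
  have hQ : ‖Q‖ ≤ 2 := norm_weightedComp_le
  let R : ℓ∞ →L[ℝ] ℓ∞ := ContinuousLinearMap.id ℝ ℓ∞ - Q ∘L T ∘L M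
  have hR : ‖R‖ ≤ 1 / 2 := by
    refine R.opNorm_le_bound (by norm_num) fun x => norm_le (by positivity) fun k => ?_
    let y : ℓ∞ := M x - x k • lp.single ∞ (b k) (1 : ℝ)
    have hMb : M x (b k) = x k := by
      simp [M, hbB k, Function.leftInverse_invFun hb k]
    have hyb : y (b k) = 0 := by
      rw [sub_apply, smul_apply, hMb, lp.single_apply_self, mul_one, sub_self]
    have hyM : ∀ m, m ≠ b k → y m = M x m := fun m hm => by
      rw [sub_apply, smul_apply, lp.single_apply_ne _ _ _ hm, mul_zero, sub_zero]
    have hyx : ‖y‖ ≤ ‖x‖ := by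
      refine norm_le (norm_nonneg _) fun m => ?_
      rcases eq_or_ne m (b k) with rfl | hm
      · simp [hyb]
      · rw [hyM m hm]
        exact (abs_apply_le _ m).trans ((M.le_opNorm x).trans
          (mul_le_of_le_one_left (norm_nonneg _) hM))
    have hysupp : ∀ m ∉ B \ {b k}, y m = 0 := fun m hm => by
      rcases eq_or_ne m (b k) with rfl | hmb
      · exact hyb
      · have hmB : m ∉ B := fun h => hm ⟨h, hmb⟩
        rw [hyM m hmb]
        simp [M, hmB]
    have hTy : |T y (b k)| ≤ 1 / 4 * ‖x‖ :=
      (abs_apply_le_rowVariation_mul_norm T (b k) hysupp).trans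
        (mul_le_mul (hsmall _ (hbB k)) hyx (norm_nonneg _) (by norm_num))
    have hTM : T (M x) (b k) = T y (b k) + x k * d k := by
      rw [map_sub, map_smul, sub_apply, smul_apply, sub_add_cancel]
    have hdk : d k ≠ 0 := by linarith [hd k]
    have hRk : R x k = -((d k)⁻¹ * T y (b k)) := by
      change x k - (d k)⁻¹ * T (M x) (b k) = _
      rw [hTM]
      field_simp
      ring
    rw [hRk, abs_neg, abs_mul]
    calc |(d k)⁻¹| * |T y (b k)| ≤ 2 * (1 / 4 * ‖x‖) :=
          mul_le_mul (hd_inv k) hTy (abs_nonneg _) two_pos.le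
      _ = 1 / 2 * ‖x‖ := by ring
  have hR_lt : ‖R‖ < 1 := by linarith
  let U : ℓ∞ →L[ℝ] ℓ∞ := ∑' j : ℕ, R ^ j
  have hU : U * (1 - R) = 1 := geom_series_mul_neg R hR_lt
  have hUnorm : ‖U‖ ≤ 2 := by
    have h : U = 1 + U * R := by
      rw [mul_sub, mul_one, sub_eq_iff_eq_add] at hU
      exact hU
    have h₁ : ‖U‖ ≤ 1 + ‖U‖ * ‖R‖ := by
      calc ‖U‖ = ‖1 + U * R‖ := by rw [← h]
        _ ≤ ‖(1 : ℓ∞ →L[ℝ] ℓ∞)‖ + ‖U * R‖ := norm_add_le _ _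
        _ ≤ 1 + ‖U‖ * ‖R‖ := add_le_add ContinuousLinearMap.norm_id_le (norm_mul_le _ _)
    nlinarith [norm_nonneg U]
  refine ⟨M, U ∘L Q, ?_, ?_⟩
  · have hUQ : ‖U ∘L Q‖ ≤ 2 * 2 :=
      (U.opNorm_comp_le Q).trans (mul_le_mul hUnorm hQ (norm_nonneg _) two_pos.le)
    calc ‖M‖ * ‖U ∘L Q‖ ≤ 1 * (2 * 2) :=
          mul_le_mul hM hUQ (norm_nonneg _) zero_le_one
      _ = 4 := by norm_num
  · have hR' : 1 - R = Q ∘L T ∘L M := sub_sub_cancel _ _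
    rw [hR'] at hU
    exact hU

end LInfty

/-- **Theorem 1.1 instantiated at `ℓ∞` (`K_u = K_s = 1`).**  For every bounded linear operator
`T` on `ℓ∞` there exist bounded linear operators `M, N` on `ℓ∞` with `‖M‖·‖N‖ ≤ 48` such that
`N ∘ T ∘ M = Id` or `N ∘ (Id − T) ∘ M = Id`. -/
theorem linfty_factorization
    (T : lp (fun _ : ℕ => ℝ) ∞ →L[ℝ] lp (fun _ : ℕ => ℝ) ∞) :
    ∃ M N : lp (fun _ : ℕ => ℝ) ∞ →L[ℝ] lp (fun _ : ℕ => ℝ) ∞,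
      ‖M‖ * ‖N‖ ≤ 48 ∧
      (N ∘L T ∘L M = ContinuousLinearMap.id ℝ (lp (fun _ : ℕ => ℝ) ∞) ∨
        N ∘L (ContinuousLinearMap.id ℝ (lp (fun _ : ℕ => ℝ) ∞) - T) ∘L M =
          ContinuousLinearMap.id ℝ (lp (fun _ : ℕ => ℝ) ∞)) := by
  by_cases hA : {n | 1 / 2 ≤ T (lp.single ∞ n (1 : ℝ)) n}.Infinite
  · obtain ⟨M, N, hMN, h⟩ := LInfty.exists_factorization_of_large_diagonal T hA fun _ hn => hn
    exact ⟨M, N, hMN.trans (by norm_num), Or.inl h⟩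
  · have hdiag : ∀ n ∈ {n | 1 / 2 ≤ T (lp.single ∞ n (1 : ℝ)) n}ᶜ,
        1 / 2 ≤ (ContinuousLinearMap.id ℝ (lp (fun _ : ℕ => ℝ) ∞) - T)
          (lp.single ∞ n (1 : ℝ)) n := fun n hn => by
      have hn' : T (lp.single ∞ n (1 : ℝ)) n < 1 / 2 := not_le.1 hn
      rw [sub_apply, LInfty.sub_apply, ContinuousLinearMap.id_apply, lp.single_apply_self]
      linarith
    obtain ⟨M, N, hMN, h⟩ := LInfty.exists_factorization_of_large_diagonal _
      (Set.not_infinite.1 hA).infinite_compl hdiag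
    exact ⟨M, N, hMN.trans (by norm_num), Or.inr h⟩
end

section
/- Let 1 < q < ∞. For every bounded linear operator T : ℓ^q → ℓ^q there exist bounded linear operators M, N : ℓ^q → ℓ^q with ‖M‖·‖N‖ ≤ 48 such that either N ∘ T ∘ M = Id or N ∘ (Id − T) ∘ M = Id, where Id denotes the identity operator on ℓ^q. -/
open scoped ENNReal

open Filter Topology in
/-- If the rows and columns of an infinite matrix tend to zero, then along a suitable subsequence
of any prescribed infinite set of indices the off-diagonal entries are as small as we like. -/
theorem exists_strictMono_offDiag_small {A : Set ℕ} (hA : A.Infinite) {a : ℕ → ℕ → ℝ}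
    (hrow : ∀ m, Tendsto (fun n => a m n) atTop (𝓝 0))
    (hcol : ∀ n, Tendsto (fun m => a m n) atTop (𝓝 0))
    {δ : ℕ → ℝ} (hδ : ∀ n, 0 < δ n) (hanti : Antitone δ) :
    ∃ φ : ℕ → ℕ, StrictMono φ ∧ (∀ k, φ k ∈ A) ∧ ∀ j k, j ≠ k → |a (φ j) (φ k)| ≤ δ j * δ k := by
  -- The first component of each chosen pair only keeps track of its position in the sequence.
  obtain ⟨f, hf, hlt⟩ := exists_seq_of_forall_finset_exists (α := ℕ × ℕ) (fun x => x.2 ∈ A)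
    (fun x y => x.1 < y.1 ∧ x.2 < y.2 ∧ |a x.2 y.2| ≤ δ x.1 * δ y.1 ∧
      |a y.2 x.2| ≤ δ x.1 * δ y.1) (by
    intro s _
    obtain ⟨i, hi⟩ : ∃ i, ∀ x ∈ s, x.1 < i :=
      ⟨s.sup Prod.fst + 1, fun x hx => Nat.lt_succ_of_le (Finset.le_sup (f := Prod.fst) hx)⟩
    have hev : ∀ᶠ n in atTop, ∀ x ∈ s, x.2 < n ∧ |a x.2 n| ≤ δ x.1 * δ i ∧
        |a n x.2| ≤ δ x.1 * δ i := by
      refine (eventually_all_finset s).2 fun x _ => ?_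
      have hpos : 0 < δ x.1 * δ i := mul_pos (hδ _) (hδ _)
      filter_upwards [eventually_gt_atTop x.2,
        (hrow x.2).abs.eventually (ge_mem_nhds (by simpa using hpos)),
        (hcol x.2).abs.eventually (ge_mem_nhds (by simpa using hpos))] with n h₁ h₂ h₃
      exact ⟨h₁, h₂, h₃⟩
    obtain ⟨n, hnA, hn⟩ := ((Nat.frequently_atTop_iff_infinite.2 hA).and_eventually hev).exists
    exact ⟨(i, n), hnA, fun x hx => ⟨hi x hx, hn x hx⟩⟩)
  have hle : ∀ n, n ≤ (f n).1 := fun _ =>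
    StrictMono.le_apply (f := fun n => (f n).1) fun m n h => (hlt m n h).1
  have hδle : ∀ j k, δ (f j).1 * δ (f k).1 ≤ δ j * δ k := fun j k =>
    mul_le_mul (hanti (hle j)) (hanti (hle k)) (hδ _).le (hδ _).le
  refine ⟨fun n => (f n).2, fun m n h => (hlt m n h).2.1, hf, fun j k hjk => ?_⟩
  rcases lt_or_gt_of_ne hjk with h | h
  · exact (hlt j k h).2.2.1.trans (hδle j k)
  · rw [mul_comm]
    exact (hlt k j h).2.2.2.trans (hδle k j)

namespace lp

variable {p : ℝ≥0∞}

open Filter Topology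

theorem norm_le_of_hasSum_bound {ι : Type*} [Fact (1 ≤ p)] (hp : p ≠ ∞)
    {x : lp (fun _ : ι => ℝ) p} {d : ι → ℝ} {D : ℝ} (hd : HasSum d D) (hx : ∀ i, |x i| ≤ d i) :
    ‖x‖ ≤ D := by
  have hp₀ : 0 < p := zero_lt_one.trans_le Fact.out
  classical
  rw [← (lp.hasSum_single hp x).tsum_eq]
  exact tsum_of_norm_bounded hd fun i => by simpa [lp.norm_single hp₀] using hx i

theorem opNorm_le_of_hasSum_bound {ι F : Type*} [Fact (1 ≤ p)] (hp : p ≠ ∞)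
    [NormedAddCommGroup F] [NormedSpace ℝ F] {E : lp (fun _ : ι => ℝ) p →L[ℝ] F} {c : ι → ℝ} {C : ℝ}
    [DecidableEq ι] (hc : HasSum c C) (hE : ∀ i, ‖E (lp.single p i 1)‖ ≤ c i) : ‖E‖ ≤ C := by
  have hp₀ : p ≠ 0 := (zero_lt_one.trans_le Fact.out).ne'
  refine E.opNorm_le_bound (hc.nonneg fun i => (norm_nonneg _).trans (hE i)) fun x => ?_
  rw [← ((lp.hasSum_single hp x).mapL E).tsum_eq]
  refine tsum_of_norm_bounded (hc.mul_right ‖x‖) fun i => ?_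
  have hsingle : lp.single p i (x i) = x i • lp.single (E := fun _ => ℝ) p i 1 := by
    rw [← lp.single_smul, smul_eq_mul, mul_one]
  rw [hsingle, map_smul, norm_smul, mul_comm]
  exact mul_le_mul (hE i) (lp.norm_apply_le_norm hp₀ x i) (norm_nonneg _)
    ((norm_nonneg _).trans (hE i))

theorem tendsto_apply_cofinite {ι : Type*} (hp : 0 < p.toReal) (x : lp (fun _ : ι => ℝ) p) :
    Tendsto (fun i => x i) cofinite (𝓝 0) := by
  have h := ((lp.memℓp x).summable hp).tendsto_cofinite_zero.rpow_const
    (p := p.toReal⁻¹) (Or.inr (by positivity))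
  rw [Real.zero_rpow (by positivity)] at h
  refine tendsto_zero_iff_norm_tendsto_zero.2 (h.congr fun i => ?_)
  exact Real.rpow_rpow_inv (norm_nonneg _) hp.ne'

/-- For `1 < p < ∞` the standard unit vectors of `ℓ^p` are weakly null. -/
theorem tendsto_apply_single_cofinite {ι : Type*} [DecidableEq ι] [Fact (1 ≤ p)]
    (hp : 1 < p) (hp' : p ≠ ∞) (g : lp (fun _ : ι => ℝ) p →L[ℝ] ℝ) :
    Tendsto (fun i => g (lp.single p i 1)) cofinite (𝓝 0) := by
  have h1 : 1 < p.toReal := by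
    simpa using (ENNReal.toReal_lt_toReal ENNReal.one_ne_top hp').2 hp
  have h0 : 0 < p.toReal := one_pos.trans h1
  refine tendsto_zero_iff_norm_tendsto_zero.2 (Metric.tendsto_nhds.2 fun ε hε => ?_)
  rw [eventually_cofinite]
  by_contra hinf
  have key : ∀ n : ℕ, 0 < n → (n : ℝ) ^ (1 - p.toReal⁻¹) ≤ ‖g‖ / ε := by
    intro n hn
    obtain ⟨s, hs, hcard⟩ := Set.Infinite.exists_subset_card_eq hinf n
    set b : ι → ℝ := fun i => SignType.sign (g (lp.single p i 1)) with hb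
    have hge : ∀ i ∈ s, ε ≤ |g (lp.single p i 1)| := fun i hi => by
      simpa using hs hi
    have hb1 : ∀ i ∈ s, ‖b i‖ ^ p.toReal = 1 := fun i hi => by
      have hne : g (lp.single p i 1) ≠ 0 := abs_pos.1 (hε.trans_le (hge i hi))
      rcases lt_or_gt_of_ne hne with h | h <;> simp [hb, h]
    have hnorm : ‖∑ i ∈ s, lp.single p i (b i)‖ = (n : ℝ) ^ p.toReal⁻¹ := by
      have h := lp.norm_sum_single h0 b s
      rw [Finset.sum_congr rfl hb1, Finset.sum_const, hcard, nsmul_eq_mul, mul_one] at h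
      rw [← h, Real.rpow_rpow_inv (norm_nonneg _) h0.ne']
    have hval : g (∑ i ∈ s, lp.single p i (b i)) = ∑ i ∈ s, |g (lp.single p i 1)| := by
      rw [map_sum]
      refine Finset.sum_congr rfl fun i _ => ?_
      have hsingle : lp.single p i (b i) = b i • lp.single (E := fun _ => ℝ) p i 1 := by
        rw [← lp.single_smul, smul_eq_mul, mul_one]
      rw [hsingle, map_smul, smul_eq_mul, hb, sign_mul_self]
    have hle : (n : ℝ) * ε ≤ ‖g‖ * (n : ℝ) ^ p.toReal⁻¹ := by
      calc (n : ℝ) * ε = ∑ i ∈ s, ε := by rw [Finset.sum_const, hcard, nsmul_eq_mul]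
        _ ≤ g (∑ i ∈ s, lp.single p i (b i)) := hval ▸ Finset.sum_le_sum hge
        _ ≤ ‖g‖ * (n : ℝ) ^ p.toReal⁻¹ := hnorm ▸ (le_abs_self _).trans (g.le_opNorm _)
    have hn' : (0 : ℝ) < n := by exact_mod_cast hn
    rw [Real.rpow_sub hn', Real.rpow_one, div_le_div_iff₀ (by positivity) hε]
    exact hle
  have hexp : 0 < 1 - p.toReal⁻¹ := sub_pos.2 (inv_lt_one_of_one_lt₀ h1)
  have htop := (tendsto_rpow_atTop hexp).comp (tendsto_natCast_atTop_atTop (R := ℝ))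
  obtain ⟨n, hn, hn0⟩ :=
    ((htop.eventually_gt_atTop (‖g‖ / ε)).and (eventually_gt_atTop 0)).exists
  exact (key n hn0).not_gt hn

/-- Coordinate substitution along an injection followed by a bounded diagonal operator. -/
theorem exists_weighted_comp {ι κ : Type*} [Fact (1 ≤ p)] (hp : p ≠ ∞) {φ : κ → ι}
    (hφ : Function.Injective φ) {w : κ → ℝ} {C : ℝ} (hC : 0 ≤ C) (hw : ∀ k, |w k| ≤ C) :
    ∃ P : lp (fun _ : ι => ℝ) p →L[ℝ] lp (fun _ : κ => ℝ) p,
      ‖P‖ ≤ C ∧ ∀ x k, P x k = w k * x (φ k) := by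
  have hp₀ : 0 < p.toReal := ENNReal.toReal_pos (zero_lt_one.trans_le Fact.out).ne' hp
  have hsum : ∀ (x : lp (fun _ : ι => ℝ) p) (s : Finset κ),
      ∑ k ∈ s, ‖w k * x (φ k)‖ ^ p.toReal ≤ (C * ‖x‖) ^ p.toReal := fun x s =>
    calc ∑ k ∈ s, ‖w k * x (φ k)‖ ^ p.toReal
        ≤ ∑ k ∈ s, C ^ p.toReal * ‖x (φ k)‖ ^ p.toReal := by
          refine Finset.sum_le_sum fun k _ => ?_
          rw [norm_mul, Real.mul_rpow (norm_nonneg _) (norm_nonneg _)]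
          gcongr
          exact hw k
      _ = C ^ p.toReal * ∑ i ∈ s.map ⟨φ, hφ⟩, ‖x i‖ ^ p.toReal := by
          rw [← Finset.mul_sum, Finset.sum_map]
          rfl
      _ ≤ C ^ p.toReal * ‖x‖ ^ p.toReal := by
          gcongr
          exact lp.sum_rpow_le_norm_rpow hp₀ x _
      _ = (C * ‖x‖) ^ p.toReal := (Real.mul_rpow hC (norm_nonneg _)).symm
  let L : lp (fun _ : ι => ℝ) p →ₗ[ℝ] lp (fun _ : κ => ℝ) p :=
    { toFun := fun x => ⟨fun k => w k * x (φ k), memℓp_gen' (hsum x)⟩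
      map_add' := fun x y => by
        ext k
        exact mul_add _ _ _
      map_smul' := fun c x => by
        ext k
        exact mul_left_comm _ _ _ }
  have hL : ∀ x, ‖L x‖ ≤ C * ‖x‖ := fun x =>
    lp.norm_le_of_forall_sum_le hp₀ (by positivity) (hsum x)
  exact ⟨L.mkContinuous C hL, L.mkContinuous_norm_le hC hL, fun _ _ => rfl⟩

/-- Moving the coordinates of a sequence along an injection, extending by zero. -/
theorem exists_extend {ι κ : Type*} [DecidableEq ι] [DecidableEq κ] [Fact (1 ≤ p)] (hp : p ≠ ∞)
    {φ : κ → ι} (hφ : Function.Injective φ) :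
    ∃ M : lp (fun _ : κ => ℝ) p →L[ℝ] lp (fun _ : ι => ℝ) p,
      ‖M‖ ≤ 1 ∧ ∀ k, M (lp.single p k 1) = lp.single p (φ k) 1 := by
  have hp₀ : 0 < p.toReal := ENNReal.toReal_pos (zero_lt_one.trans_le Fact.out).ne' hp
  have hsum : ∀ x : lp (fun _ : κ => ℝ) p,
      HasSum (fun i => ‖(Function.extend φ x 0 i : ℝ)‖ ^ p.toReal) (‖x‖ ^ p.toReal) := fun x => by
    refine (hφ.hasSum_iff fun i hi => ?_).1 ?_
    · rw [Function.extend_apply' _ _ _ hi]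
      simp [hp₀.ne']
    · simpa [Function.comp_def, hφ.extend_apply] using lp.hasSum_norm hp₀ x
  let L : lp (fun _ : κ => ℝ) p →ₗ[ℝ] lp (fun _ : ι => ℝ) p :=
    { toFun := fun x => ⟨Function.extend φ x 0, memℓp_gen (hsum x).summable⟩
      map_add' := fun x y => by
        ext i
        have h := congrFun (Function.extend_add φ (x : κ → ℝ) (y : κ → ℝ) 0 0) i
        rwa [add_zero] at h
      map_smul' := fun c x => by
        ext i
        simpa using congrFun (Function.extend_smul c φ x 0) i }
  have hL : ∀ x, ‖L x‖ ≤ 1 * ‖x‖ := fun x => by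
    rw [one_mul]
    exact lp.norm_le_of_tsum_le hp₀ (norm_nonneg _) (hsum x).tsum_eq.le
  refine ⟨L.mkContinuous 1 hL, L.mkContinuous_norm_le zero_le_one hL, fun k => ?_⟩
  ext i
  change Function.extend φ (Pi.single k 1 : κ → ℝ) 0 i = (Pi.single (φ k) 1 : ι → ℝ) i
  by_cases hi : ∃ l, φ l = i
  · obtain ⟨l, rfl⟩ := hi
    simp [hφ.extend_apply, Pi.single_apply, hφ.eq_iff]
  · rw [Function.extend_apply' _ _ _ hi, Pi.zero_apply,
      Pi.single_eq_of_ne (M := fun _ : ι => ℝ) (fun h => hi ⟨k, h.symm⟩ : i ≠ φ k)]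

end lp

theorem ContinuousLinearMap.exists_left_inverse_of_norm_one_sub_le {E : Type*}
    [NormedAddCommGroup E] [NormedSpace ℝ E] [CompleteSpace E] {S : E →L[ℝ] E}
    (hS : ‖1 - S‖ ≤ 1 / 2) : ∃ R : E →L[ℝ] E, ‖R‖ ≤ 2 ∧ R * S = 1 := by
  have hlt : ‖1 - S‖ < 1 := hS.trans_lt (by norm_num)
  refine ⟨∑' n : ℕ, (1 - S) ^ n, ?_, ?_⟩
  · have h1 : ‖(1 : E →L[ℝ] E)‖ ≤ 1 := ContinuousLinearMap.norm_id_le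
    have h2 : (1 - ‖1 - S‖)⁻¹ ≤ 2 := inv_le_of_inv_le₀ (by norm_num) (by linarith)
    linarith [tsum_geometric_le_of_norm_lt_one (1 - S) hlt]
  · simpa using geom_series_mul_neg (1 - S) hlt

/-- The identity of `ℓ^p` factors through every operator with a large diagonal. -/
theorem lp.exists_factorization_of_infinite_diag {p : ℝ≥0∞} [Fact (1 ≤ p)] (hp : 1 < p)
    (hp' : p ≠ ∞) (T : lp (fun _ : ℕ => ℝ) p →L[ℝ] lp (fun _ : ℕ => ℝ) p)
    (hT : {n | 1 / 2 ≤ |T (lp.single p n 1) n|}.Infinite) :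
    ∃ M N : lp (fun _ : ℕ => ℝ) p →L[ℝ] lp (fun _ : ℕ => ℝ) p,
      ‖M‖ * ‖N‖ ≤ 4 ∧ N ∘L T ∘L M = ContinuousLinearMap.id ℝ (lp (fun _ : ℕ => ℝ) p) := by
  have hp₀ : 0 < p.toReal := ENNReal.toReal_pos (zero_lt_one.trans hp).ne' hp'
  have hδ : HasSum (fun n : ℕ => (1 / 4 : ℝ) * (1 / 2) ^ n) (1 / 2) := by
    have h := hasSum_geometric_two.mul_left (1 / 4 : ℝ)
    norm_num at h ⊢
    exact h
  set δ : ℕ → ℝ := fun n => (1 / 4 : ℝ) * (1 / 2) ^ n with hδ_def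
  obtain ⟨φ, hφ, hdiag, hoff⟩ := exists_strictMono_offDiag_small hT
    (a := fun m n => T (lp.single p n 1) m) (δ := δ)
    (fun m => by
      rw [← Nat.cofinite_eq_atTop]
      exact lp.tendsto_apply_single_cofinite hp hp' (lp.evalCLM ℝ (fun _ => ℝ) p m ∘L T))
    (fun n => by
      simpa [Nat.cofinite_eq_atTop] using
        lp.tendsto_apply_cofinite hp₀ (T (lp.single p n 1)))
    (fun n => by positivity)
    (fun m n h => mul_le_mul_of_nonneg_left
      (pow_le_pow_of_le_one (by norm_num) (by norm_num) h) (by norm_num))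
  have hw : ∀ k, |(T (lp.single p (φ k) 1) (φ k))⁻¹| ≤ 2 := fun k => by
    rw [abs_inv]
    exact inv_le_of_inv_le₀ (by norm_num) (by simpa using hdiag k)
  obtain ⟨M, hM, hMsingle⟩ := lp.exists_extend hp' hφ.injective
  obtain ⟨P, hP, hPapply⟩ := lp.exists_weighted_comp hp' hφ.injective zero_le_two hw
  have hS : ‖1 - P * (T * M)‖ ≤ 1 / 2 := by
    refine lp.opNorm_le_of_hasSum_bound hp' hδ fun k => ?_
    have hsum : HasSum (fun j => 2 * (δ j * δ k)) (δ k) := by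
      simpa using (hδ.mul_right (δ k)).mul_left 2
    refine lp.norm_le_of_hasSum_bound hp' hsum fun j => ?_
    have hentry : (1 - P * (T * M)) (lp.single p k 1) j = lp.single (E := fun _ => ℝ) p k 1 j -
        (T (lp.single p (φ j) 1) (φ j))⁻¹ * T (lp.single p (φ k) 1) (φ j) := by
      rw [← hMsingle k, ← hPapply]
      rfl
    rw [hentry]
    rcases eq_or_ne j k with rfl | hjk
    · have hne : T (lp.single p (φ j) 1) (φ j) ≠ 0 :=
        abs_pos.1 (one_half_pos.trans_le (hdiag j))
      rw [lp.single_apply_self, inv_mul_cancel₀ hne, sub_self, abs_zero]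
      positivity
    · rw [lp.single_apply_ne _ _ _ hjk, zero_sub, abs_neg, abs_mul]
      exact mul_le_mul (hw j) (hoff j k hjk) (abs_nonneg _) zero_le_two
  obtain ⟨R, hR, hRS⟩ := ContinuousLinearMap.exists_left_inverse_of_norm_one_sub_le hS
  refine ⟨M, R * P, ?_, ?_⟩
  · calc ‖M‖ * ‖R * P‖ ≤ 1 * (2 * 2) := by
          gcongr
          exact (norm_mul_le R P).trans (by gcongr)
      _ = 4 := by norm_num
  · change R * P * (T * M) = 1
    rw [mul_assoc, hRS]

/-- **Theorem 1.1 instantiated at `ℓ^q`, `1 < q < ∞` (`K_u = K_s = 1`).**  For every bounded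
linear operator `T` on `ℓ^q` there exist bounded linear operators `M, N` on `ℓ^q` with
`‖M‖·‖N‖ ≤ 48` such that `N ∘ T ∘ M = Id` or `N ∘ (Id − T) ∘ M = Id`. -/
theorem lq_factorization
    (q : ℝ≥0∞) [Fact (1 ≤ q)] (hq : 1 < q) (hq' : q < ∞)
    (T : lp (fun _ : ℕ => ℝ) q →L[ℝ] lp (fun _ : ℕ => ℝ) q) :
    ∃ M N : lp (fun _ : ℕ => ℝ) q →L[ℝ] lp (fun _ : ℕ => ℝ) q,
      ‖M‖ * ‖N‖ ≤ 48 ∧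
      (N ∘L T ∘L M = ContinuousLinearMap.id ℝ (lp (fun _ : ℕ => ℝ) q) ∨
        N ∘L (ContinuousLinearMap.id ℝ (lp (fun _ : ℕ => ℝ) q) - T) ∘L M =
          ContinuousLinearMap.id ℝ (lp (fun _ : ℕ => ℝ) q)) := by
  have hunion : {n | 1 / 2 ≤ |T (lp.single q n 1) n|} ∪
      {n | 1 / 2 ≤ |(ContinuousLinearMap.id ℝ (lp (fun _ : ℕ => ℝ) q) - T) (lp.single q n 1) n|} =
      Set.univ := by
    refine Set.eq_univ_of_forall fun n => ?_
    by_contra hn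
    simp only [Set.mem_union, Set.mem_ofPred_eq, not_or, not_le] at hn
    have hsub : (ContinuousLinearMap.id ℝ (lp (fun _ : ℕ => ℝ) q) - T) (lp.single q n 1) n =
        1 - T (lp.single q n 1) n := by
      simp
    rw [hsub] at hn
    linarith [abs_lt.1 hn.1, abs_lt.1 hn.2]
  have hinf := Set.infinite_univ (α := ℕ)
  rw [← hunion, Set.infinite_union] at hinf
  rcases hinf with h | h
  · obtain ⟨M, N, hMN, hid⟩ := lp.exists_factorization_of_infinite_diag hq hq'.ne T h
    exact ⟨M, N, hMN.trans (by norm_num), Or.inl hid⟩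
  · obtain ⟨M, N, hMN, hid⟩ := lp.exists_factorization_of_infinite_diag hq hq'.ne _ h
    exact ⟨M, N, hMN.trans (by norm_num), Or.inr hid⟩
end

section
/- For every bounded linear operator T : ℓ∞ → ℓ∞ there exists H ∈ {T, Id − T} such that the image H(ℓ∞) contains a closed linear subspace Y that is isomorphic to ℓ∞ (there is a continuous linear equivalence between Y, with the induced norm, and ℓ∞) and complemented in ℓ∞ (there is a bounded linear projection of ℓ∞ onto Y). -/
open scoped ENNReal

/-- The operator `x ↦ (n ↦ w n * x (φ n))` on `ℓ∞`, for a bounded weight `w`. -/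
noncomputable def linftyWeightedComp (w : ℕ → ℝ) (C : ℝ) (hw : ∀ n, |w n| ≤ C) (φ : ℕ → ℕ) :
    lp (fun _ : ℕ => ℝ) ∞ →L[ℝ] lp (fun _ : ℕ => ℝ) ∞ :=
  have bound (x : lp (fun _ : ℕ => ℝ) ∞) (n : ℕ) : ‖w n * x (φ n)‖ ≤ C * ‖x‖ := by
    rw [norm_mul]
    exact mul_le_mul (hw n) (lp.norm_apply_le_norm ENNReal.top_ne_zero x _) (norm_nonneg _)
      ((abs_nonneg _).trans (hw n))
  LinearMap.mkContinuous
    { toFun := fun x => ⟨fun n => w n * x (φ n),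
        memℓp_infty ⟨C * ‖x‖, by rintro _ ⟨n, rfl⟩; exact bound x n⟩⟩
      map_add' := fun x y => by ext n; exact mul_add _ _ _
      map_smul' := fun c x => by ext n; exact mul_left_comm _ _ _ }
    C
    fun x => lp.norm_le_of_forall_le
      (mul_nonneg ((abs_nonneg _).trans (hw 0)) (norm_nonneg x)) (bound x)

@[simp]
theorem linftyWeightedComp_apply (w : ℕ → ℝ) (C : ℝ) (hw : ∀ n, |w n| ≤ C) (φ : ℕ → ℕ)
    (x : lp (fun _ : ℕ => ℝ) ∞) (n : ℕ) : linftyWeightedComp w C hw φ x n = w n * x (φ n) :=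
  rfl

/-- A form of Rosenthal's disjointification lemma: functionals which are uniformly bounded on the
sequences supported in an infinite set `A` become small off the diagonal on an infinite subset. -/
theorem exists_infinite_subset_offDiag_le (f : ℕ → lp (fun _ : ℕ => ℝ) ∞ →L[ℝ] ℝ) {ε : ℝ}
    (hε : 0 ≤ ε) (m : ℕ) (A : Set ℕ) (hA : A.Infinite)
    (hf : ∀ i ∈ A, ∀ x : lp (fun _ : ℕ => ℝ) ∞, ‖x‖ ≤ 1 → (∀ j ∉ A, x j = 0) →
      |f i x| ≤ m * ε) :
    ∃ B ⊆ A, B.Infinite ∧ ∀ i ∈ B, ∀ x : lp (fun _ : ℕ => ℝ) ∞, ‖x‖ ≤ 1 → (∀ j ∉ B, x j = 0) →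
      x i = 0 → |f i x| ≤ ε := by
  induction m generalizing A with
  | zero =>
    refine ⟨A, subset_rfl, hA, fun i hi x hx hxA _ => ?_⟩
    exact (hf i hi x hx hxA).trans (by simpa using hε)
  | succ m ih =>
    let e := hA.natEmbedding
    let M (p : ℕ) : Set ℕ := Set.range fun q => (e (Nat.pair p q) : ℕ)
    have hMA (p : ℕ) : M p ⊆ A := by rintro _ ⟨q, rfl⟩; exact (e _).2
    have hM (p p' i : ℕ) (h : i ∈ M p) (h' : i ∈ M p') : p = p' := by
      obtain ⟨q, rfl⟩ := h
      obtain ⟨q', h'⟩ := h'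
      exact (Nat.pair_eq_pair.1 (e.injective (Subtype.ext h'))).1.symm
    by_contra! hcon
    have hbad (p : ℕ) := hcon (M p) (hMA p) <| Set.infinite_range_of_injective fun q q' h =>
      (Nat.pair_eq_pair.1 (e.injective (Subtype.ext h))).2
    choose k hkM x hx hxM hxk hfx using hbad
    have hk : Function.Injective k := fun p p' h => hM p p' (k p) (hkM p) (h ▸ hkM p')
    have hKA : Set.range k ⊆ A := by rintro _ ⟨p, rfl⟩; exact hMA p (hkM p)
    obtain ⟨B, hBK, hB, hfB⟩ := ih (Set.range k) (Set.infinite_range_of_injective hk) (by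
      rintro _ ⟨p, rfl⟩ y hy hyK
      have hdisj (j : ℕ) : x p j = 0 ∨ y j = 0 := by
        by_cases hjK : j ∈ Set.range k
        · obtain ⟨p', rfl⟩ := hjK
          by_cases hpp : p = p'
          · exact .inl (hpp ▸ hxk p)
          · exact .inl (hxM p _ fun h => hpp (hM _ _ _ h (hkM p')))
        · exact .inr (hyK j hjK)
      have hxj (j : ℕ) := (lp.norm_apply_le_norm ENNReal.top_ne_zero (x p) j).trans (hx p)
      have hyj (j : ℕ) := (lp.norm_apply_le_norm ENNReal.top_ne_zero y j).trans hy
      have hsupp (j : ℕ) (hj : j ∉ A) : x p j = 0 ∧ y j = 0 :=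
        ⟨hxM p j fun h => hj (hMA p h), hyK j fun h => hj (hKA h)⟩
      have hadd := hf (k p) (hMA p (hkM p)) (x p + y)
        (lp.norm_le_of_forall_le zero_le_one fun j => by
          rcases hdisj j with h | h <;> simpa [h] using by first | exact hxj j | exact hyj j)
        fun j hj => by simp [hsupp j hj]
      have hsub := hf (k p) (hMA p (hkM p)) (x p - y)
        (lp.norm_le_of_forall_le zero_le_one fun j => by
          rcases hdisj j with h | h <;> simpa [h] using by first | exact hxj j | exact hyj j)
        fun j hj => by simp [hsupp j hj]
      have := hfx p
      simp only [map_add, map_sub, Nat.cast_add, Nat.cast_one, abs_le] at *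
      grind)
    obtain ⟨i, hi, x, hx, hxB, hxi, hlt⟩ := hcon B (hBK.trans hKA) hB
    exact hlt.not_ge (hfB i hi x hx hxB hxi)

/-- If `H` has infinitely many diagonal entries of absolute value at least `1 / 2`, then the
identity of `ℓ∞` factors through `H`. -/
theorem exists_comp_comp_eq_id_of_infinite_diag
    (H : lp (fun _ : ℕ => ℝ) ∞ →L[ℝ] lp (fun _ : ℕ => ℝ) ∞)
    (hH : {i | 1 / 2 ≤ |H (lp.single ∞ i (1 : ℝ)) i|}.Infinite) :
    ∃ N M : lp (fun _ : ℕ => ℝ) ∞ →L[ℝ] lp (fun _ : ℕ => ℝ) ∞, ∀ x, N (H (M x)) = x := by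
  obtain ⟨m, hm⟩ := exists_nat_ge (‖H‖ * 4)
  obtain ⟨B, hBA, hB, hoff⟩ := exists_infinite_subset_offDiag_le
    (fun i => (lp.evalCLM ℝ (fun _ : ℕ => ℝ) ∞ i).comp H)
    (ε := 1 / 4) (by norm_num) m _ hH (by
      intro i _ x hx _
      calc ‖H x i‖ ≤ ‖H x‖ := lp.norm_apply_le_norm ENNReal.top_ne_zero _ _
        _ ≤ ‖H‖ * ‖x‖ := H.le_opNorm x
        _ ≤ ‖H‖ * 1 := by gcongr
        _ ≤ m * (1 / 4) := by linarith)
  let φ : ℕ → ℕ := Nat.nth (· ∈ B)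
  have hφB (n : ℕ) : φ n ∈ B := Nat.nth_mem_of_infinite hB n
  have hφ : Function.Injective φ := Nat.nth_injective hB
  let d (n : ℕ) : ℝ := H (lp.single ∞ (φ n) (1 : ℝ)) (φ n)
  have hd (n : ℕ) : 1 / 2 ≤ |d n| := hBA (hφB n)
  have hd' (n : ℕ) : |(d n)⁻¹| ≤ 2 := by
    rw [abs_inv]
    exact inv_le_of_inv_le₀ (by norm_num) (by simpa using hd n)
  let M := linftyWeightedComp (B.indicator 1) 1
    (fun n => by by_cases h : n ∈ B <;> simp [h]) (Function.invFun φ)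
  let N := linftyWeightedComp (fun n => (d n)⁻¹) 2 hd' φ
  have hMB (x) (j : ℕ) (hj : j ∉ B) : M x j = 0 := by simp [M, hj]
  have hMφ (x) (n : ℕ) : M x (φ n) = x n := by
    simp [M, hφB n, Function.leftInverse_invFun hφ n]
  have hMle (x) (j : ℕ) : |M x j| ≤ ‖x‖ := by
    by_cases hj : j ∈ B
    · simpa [M, hj] using lp.norm_apply_le_norm ENNReal.top_ne_zero x _
    · simp [hMB x j hj]
  have hsmall : ‖1 - N * H * M‖ < 1 := by
    refine (ContinuousLinearMap.opNorm_le_of_unit_norm (C := 1 / 2) (by norm_num)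
      fun x hx => ?_).trans_lt (by norm_num)
    refine lp.norm_le_of_forall_le (by norm_num) fun n => ?_
    set r := M x - x n • lp.single ∞ (φ n) (1 : ℝ) with hr
    have hrj (j : ℕ) : r j = M x j - x n * (lp.single ∞ (φ n) (1 : ℝ) : lp (fun _ : ℕ => ℝ) ∞) j :=
      rfl
    have hrφ : r (φ n) = 0 := by simp [hrj, hMφ]
    have hrne (j : ℕ) (hj : j ≠ φ n) : r j = M x j := by simp [hrj, hj]
    have hrle := hoff (φ n) (hφB n) r
      (lp.norm_le_of_forall_le zero_le_one fun j => by
        by_cases hj : j = φ n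
        · simp [hj, hrφ]
        · rw [hrne j hj]; exact (hMle x j).trans hx.le)
      (fun j hj => by rw [hrne j fun h => hj (h ▸ hφB n), hMB x j hj]) hrφ
    have hHr : H r (φ n) = H (M x) (φ n) - x n * d n := by
      rw [hr, map_sub, map_smul]
      rfl
    have hd0 : d n ≠ 0 := fun h => by have := hd n; norm_num [h] at this
    have hcoord : (1 - N * H * M) x n = -((d n)⁻¹ * H r (φ n)) := by
      change x n - (d n)⁻¹ * H (M x) (φ n) = _
      rw [hHr]
      field_simp
      ring
    rw [hcoord, norm_neg, norm_mul]
    calc _ ≤ (2 : ℝ) * (1 / 4) := mul_le_mul (hd' n) hrle (abs_nonneg _) zero_le_two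
      _ = 1 / 2 := by norm_num
  obtain ⟨u, hu⟩ : IsUnit (N * H * M) :=
    sub_sub_cancel 1 (N * H * M) ▸ isUnit_one_sub_of_norm_lt_one hsmall
  refine ⟨↑u⁻¹ * N, M, fun x => ?_⟩
  have := DFunLike.congr_fun u.inv_mul x
  rwa [hu] at this

/-- If `N ∘ L` is the identity, then the range of `L` is closed, isomorphic to the domain of `L`
and complemented. -/
theorem exists_complemented_of_leftInverse {E F : Type*} [NormedAddCommGroup E] [NormedSpace ℝ E]
    [NormedAddCommGroup F] [NormedSpace ℝ F] (L : E →L[ℝ] F) (N : F →L[ℝ] E)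
    (h : ∀ x, N (L x) = x) :
    IsClosed (L.range : Set F) ∧ Nonempty (L.range ≃L[ℝ] E) ∧
      ∃ Q : F →L[ℝ] F, (∀ z, Q z ∈ L.range) ∧ ∀ y ∈ L.range, Q y = y := by
  refine ⟨?_, ⟨.equivOfInverse (N.comp L.range.subtypeL) L.rangeRestrict ?_ h⟩, L.comp N,
    fun z => ⟨N z, rfl⟩, ?_⟩
  · exact Function.LeftInverse.isClosed_range h N.continuous L.continuous
  · rintro ⟨_, x, rfl⟩
    exact Subtype.ext (congrArg L (h x))
  · rintro _ ⟨x, rfl⟩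
    exact congrArg L (h x)

/-- **"Consequently" part of Theorem 1.1 at `ℓ∞`.**  For every bounded linear operator `T` on
`ℓ∞` there is `H ∈ {T, Id − T}` such that `H(ℓ∞)` contains a closed subspace `Y` which is
isomorphic to `ℓ∞` and complemented in `ℓ∞`. -/
theorem linfty_contains_complemented_copy
    (T : lp (fun _ : ℕ => ℝ) ∞ →L[ℝ] lp (fun _ : ℕ => ℝ) ∞) :
    ∃ H : lp (fun _ : ℕ => ℝ) ∞ →L[ℝ] lp (fun _ : ℕ => ℝ) ∞,
      (H = T ∨ H = ContinuousLinearMap.id ℝ (lp (fun _ : ℕ => ℝ) ∞) - T) ∧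
      ∃ Y : Submodule ℝ (lp (fun _ : ℕ => ℝ) ∞),
        IsClosed (Y : Set (lp (fun _ : ℕ => ℝ) ∞)) ∧
        (Y : Set (lp (fun _ : ℕ => ℝ) ∞)) ⊆ Set.range H ∧
        Nonempty (Y ≃L[ℝ] lp (fun _ : ℕ => ℝ) ∞) ∧
        ∃ Q : lp (fun _ : ℕ => ℝ) ∞ →L[ℝ] lp (fun _ : ℕ => ℝ) ∞,
          (∀ z, Q z ∈ Y) ∧ (∀ y ∈ Y, Q y = y) := by
  have key (H : lp (fun _ : ℕ => ℝ) ∞ →L[ℝ] lp (fun _ : ℕ => ℝ) ∞)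
      (hH : {i | 1 / 2 ≤ |H (lp.single ∞ i (1 : ℝ)) i|}.Infinite) :
      ∃ Y : Submodule ℝ (lp (fun _ : ℕ => ℝ) ∞),
        IsClosed (Y : Set (lp (fun _ : ℕ => ℝ) ∞)) ∧
        (Y : Set (lp (fun _ : ℕ => ℝ) ∞)) ⊆ Set.range H ∧
        Nonempty (Y ≃L[ℝ] lp (fun _ : ℕ => ℝ) ∞) ∧
        ∃ Q : lp (fun _ : ℕ => ℝ) ∞ →L[ℝ] lp (fun _ : ℕ => ℝ) ∞,
          (∀ z, Q z ∈ Y) ∧ (∀ y ∈ Y, Q y = y) := by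
    obtain ⟨N, M, h⟩ := exists_comp_comp_eq_id_of_infinite_diag H hH
    obtain ⟨hcl, hiso, hQ⟩ := exists_complemented_of_leftInverse (H.comp M) N h
    exact ⟨_, hcl, by rintro _ ⟨x, rfl⟩; exact ⟨M x, rfl⟩, hiso, hQ⟩
  by_cases hT : {i | 1 / 2 ≤ |T (lp.single ∞ i (1 : ℝ)) i|}.Infinite
  · exact ⟨T, .inl rfl, key T hT⟩
  · refine ⟨_, .inr rfl, key _ ((Set.not_infinite.1 hT).infinite_compl.mono fun i hi => ?_)⟩
    simp only [Set.mem_compl_iff, Set.mem_ofPred_eq, not_le, abs_lt] at hi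
    have : (1 : ℝ) / 2 ≤ 1 - T (lp.single ∞ i (1 : ℝ)) i := by linarith
    simpa using this.trans (le_abs_self _)
end

section
/- Let 1 < q < ∞. For every bounded linear operator T : ℓ^q → ℓ^q there exists H ∈ {T, Id − T} such that the image H(ℓ^q) contains a closed linear subspace Y that is isomorphic to ℓ^q (there is a continuous linear equivalence between Y, with the induced norm, and ℓ^q) and complemented in ℓ^q (there is a bounded linear projection of ℓ^q onto Y). -/
open Filter Topology
open scoped ENNReal

/-- If both the rows and the columns of an infinite matrix tend to zero, then along a suitable
subsequence its off-diagonal entries are summably small. -/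
theorem exists_strictMono_offDiag_le {a : ℕ → ℕ → ℝ}
    (hrow : ∀ m, Tendsto (fun n => a m n) atTop (𝓝 0))
    (hcol : ∀ n, Tendsto (fun m => a m n) atTop (𝓝 0))
    {P : ℕ → Prop} (hP : ∃ᶠ n in atTop, P n) {c : ℝ} (hc : 0 < c) :
    ∃ σ : ℕ → ℕ, StrictMono σ ∧ (∀ k, P (σ k)) ∧
      ∀ j k, j ≠ k → |a (σ j) (σ k)| ≤ c * (1 / 2) ^ j * (1 / 2) ^ k := by
  -- The second coordinate records the position in the subsequence.
  obtain ⟨f, hfP, hfr⟩ := exists_seq_of_forall_finset_exists (α := ℕ × ℕ) (fun x => P x.1)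
    (fun x y => x.1 < y.1 ∧ x.2 < y.2 ∧
      |a x.1 y.1| ≤ c * (1 / 4) ^ y.2 ∧ |a y.1 x.1| ≤ c * (1 / 4) ^ y.2) (by
    intro s _
    obtain ⟨i, hi⟩ : ∃ i, ∀ x ∈ s, x.2 < i :=
      ⟨s.sup Prod.snd + 1, fun x hx => Nat.lt_succ_of_le (Finset.le_sup (f := Prod.snd) hx)⟩
    have hpos : 0 < c * (1 / 4 : ℝ) ^ i := by positivity
    have hs : ∀ᶠ n in atTop, ∀ x ∈ s, x.1 < n ∧
        |a x.1 n| ≤ c * (1 / 4) ^ i ∧ |a n x.1| ≤ c * (1 / 4) ^ i := by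
      rw [Filter.eventually_all_finset]
      intro x _
      have hsmall : ∀ {u : ℕ → ℝ}, Tendsto u atTop (𝓝 0) →
          ∀ᶠ n in atTop, |u n| ≤ c * (1 / 4) ^ i := fun hu =>
        (tendsto_zero_iff_abs_tendsto_zero _ |>.1 hu).eventually_le_const hpos
      exact (eventually_gt_atTop x.1).and ((hsmall (hrow x.1)).and (hsmall (hcol x.1)))
    obtain ⟨n, hn, hns⟩ := (hP.and_eventually hs).exists
    exact ⟨(n, i), hn, fun x hx => ⟨(hns x hx).1, hi x hx, (hns x hx).2⟩⟩)
  have hmono : StrictMono fun n => (f n).2 := fun m n h => (hfr m n h).2.1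
  have hdecay : ∀ m n, m < n →
      c * (1 / 4 : ℝ) ^ (f n).2 ≤ c * (1 / 2) ^ m * (1 / 2) ^ n := by
    intro m n h
    have h1 : (1 / 4 : ℝ) ^ (f n).2 ≤ (1 / 4) ^ n :=
      pow_le_pow_of_le_one (by norm_num) (by norm_num) (hmono.le_apply)
    have h2 : (1 / 4 : ℝ) ^ n = (1 / 2) ^ n * (1 / 2) ^ n := by
      rw [← mul_pow]; norm_num
    have h3 : (1 / 2 : ℝ) ^ n ≤ (1 / 2) ^ m :=
      pow_le_pow_of_le_one (by norm_num) (by norm_num) h.le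
    rw [mul_assoc]
    gcongr
    rw [h2] at h1
    exact h1.trans (by gcongr)
  refine ⟨fun n => (f n).1, fun m n h => (hfr m n h).1, hfP, fun j k hjk => ?_⟩
  rcases hjk.lt_or_gt with h | h
  · exact (hfr j k h).2.2.1.trans (hdecay j k h)
  · exact (hfr k j h).2.2.2.trans ((hdecay k j h).trans_eq (by ring))

/-- If the identity of `E` factors through `H`, then the range of `H` contains a closed
complemented copy of `E`. -/
theorem exists_complemented_copy_of_factor {E : Type*} [NormedAddCommGroup E] [NormedSpace ℝ E]
    (N H M : E →L[ℝ] E) (h : ∀ x, N (H (M x)) = x) :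
    ∃ Y : Submodule ℝ E, IsClosed (Y : Set E) ∧ (Y : Set E) ⊆ Set.range H ∧
      Nonempty (Y ≃L[ℝ] E) ∧
      ∃ Q : E →L[ℝ] E, (∀ z, Q z ∈ Y) ∧ (∀ y ∈ Y, Q y = y) := by
  have hfix : ∀ y ∈ (H ∘L M).range, H (M (N y)) = y := by
    rintro _ ⟨x, rfl⟩
    exact congrArg (fun z => H (M z)) (h x)
  refine ⟨(H ∘L M).range, ?_, ?_, ⟨?_⟩, H ∘L M ∘L N, fun z => ⟨N z, rfl⟩, hfix⟩
  · have hY : ((H ∘L M).range : Set E) = {y | H (M (N y)) = y} :=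
      Set.Subset.antisymm hfix fun y hy => ⟨N y, hy⟩
    rw [hY]
    exact isClosed_eq (by fun_prop) continuous_id
  · rintro _ ⟨x, rfl⟩
    exact ⟨M x, rfl⟩
  · exact ContinuousLinearEquiv.equivOfInverse (N ∘L (H ∘L M).range.subtypeL)
      ((H ∘L M).codRestrict _ fun x => ⟨x, rfl⟩) (fun y => Subtype.ext (hfix y y.2)) h

namespace lp

open scoped lp

variable {p : ℝ≥0∞}

theorem tendsto_apply_zero [Fact (1 ≤ p)] (hp' : p ≠ ∞) (f : ℓ^p(ℕ, ℝ)) :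
    Tendsto (fun m => f m) atTop (𝓝 0) := by
  have h := (lp.hasSum_single hp' f).summable.tendsto_cofinite_zero.norm
  simp only [lp.norm_single (zero_lt_one.trans_le Fact.out : 0 < p), norm_zero] at h
  rw [← Nat.cofinite_eq_atTop]
  exact tendsto_zero_iff_norm_tendsto_zero.2 h

/-- The unit vectors of `ℓ^p`, `1 < p < ∞`, are weakly null. -/
theorem tendsto_clm_single_zero [Fact (1 ≤ p)] (hp : 1 < p) (hp' : p ≠ ∞)
    (φ : ℓ^p(ℕ, ℝ) →L[ℝ] ℝ) :
    Tendsto (fun n => φ (lp.single p n 1)) atTop (𝓝 0) := by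
  have hp1 : 1 < p.toReal := by
    simpa using (ENNReal.toReal_lt_toReal ENNReal.one_ne_top hp').2 hp
  have hp0 : 0 < p.toReal := zero_lt_one.trans hp1
  rw [← Nat.cofinite_eq_atTop, tendsto_zero_iff_abs_tendsto_zero, Metric.tendsto_nhds]
  intro ε hε
  by_contra hfreq
  have hinf : {n | ε ≤ |φ (lp.single p n 1)|}.Infinite := by
    intro hfin
    refine hfreq ((eventually_cofinite).2 (hfin.subset fun n hn => ?_))
    simpa using hn
  have hbound : ∀ N : ℕ, 0 < N → (N : ℝ) ^ (p.toReal - 1) ≤ (‖φ‖ / ε) ^ p.toReal := by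
    intro N hN
    obtain ⟨F, hF, hFN⟩ := hinf.exists_subset_card_eq N
    set s : ℕ → ℝ := fun n => SignType.sign (φ (lp.single p n 1)) with hs
    set x : ℓ^p(ℕ, ℝ) := ∑ n ∈ F, lp.single p n (s n) with hx
    have hφx : φ x = ∑ n ∈ F, |φ (lp.single p n 1)| := by
      rw [hx, map_sum]
      refine Finset.sum_congr rfl fun n _ => ?_
      have : lp.single p n (s n) = s n • (lp.single p n 1 : ℓ^p(ℕ, ℝ)) := by
        rw [← lp.single_smul]; simp
      rw [this, map_smul, smul_eq_mul, hs, sign_mul_self]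
    have hlow : N * ε ≤ φ x := by
      rw [hφx, ← hFN, ← nsmul_eq_mul]
      exact Finset.card_nsmul_le_sum _ _ _ fun n hn => hF hn
    have hnorm : ‖x‖ ^ p.toReal ≤ N := by
      rw [hx, lp.norm_sum_single hp0, ← hFN, Finset.card_eq_sum_ones, Nat.cast_sum, Nat.cast_one]
      refine Finset.sum_le_sum fun n _ => Real.rpow_le_one (norm_nonneg _) ?_ hp0.le
      rcases hsg : SignType.sign (φ (lp.single p n 1)) <;> simp [hs, hsg]
    have hle : (N : ℝ) ≤ ‖φ‖ / ε * ‖x‖ := by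
      rw [div_mul_eq_mul_div, le_div_iff₀ hε]
      exact hlow.trans ((le_abs_self _).trans (φ.le_opNorm x))
    have hN' : (0 : ℝ) < N := Nat.cast_pos.2 hN
    have hpow : (N : ℝ) ^ p.toReal ≤ (‖φ‖ / ε) ^ p.toReal * N :=
      calc (N : ℝ) ^ p.toReal ≤ (‖φ‖ / ε * ‖x‖) ^ p.toReal :=
            Real.rpow_le_rpow hN'.le hle hp0.le
        _ = (‖φ‖ / ε) ^ p.toReal * ‖x‖ ^ p.toReal :=
            Real.mul_rpow (by positivity) (norm_nonneg _)
        _ ≤ _ := by gcongr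
    rw [Real.rpow_sub_one hN'.ne']
    exact (div_le_iff₀ hN').2 hpow
  have htop : Tendsto (fun N : ℕ => (N : ℝ) ^ (p.toReal - 1)) atTop atTop :=
    (tendsto_rpow_atTop (sub_pos.2 hp1)).comp tendsto_natCast_atTop_atTop
  obtain ⟨N, hN, hN0⟩ := ((htop.eventually_gt_atTop _).and (eventually_gt_atTop 0)).exists
  exact (hbound N hN0).not_gt hN

/-- A linear map into sequences satisfying an `ℓ^p` bound induces an operator on `ℓ^p`. -/
theorem exists_clm_of_sum_rpow_le [Fact (1 ≤ p)] (hp' : p ≠ ∞) (L : ℓ^p(ℕ, ℝ) →ₗ[ℝ] ℕ → ℝ)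
    {C : ℝ} (hC : 0 ≤ C)
    (hL : ∀ x (s : Finset ℕ), ∑ i ∈ s, ‖L x i‖ ^ p.toReal ≤ (C * ‖x‖) ^ p.toReal) :
    ∃ A : ℓ^p(ℕ, ℝ) →L[ℝ] ℓ^p(ℕ, ℝ), ∀ x i, A x i = L x i := by
  have hp0 : 0 < p.toReal := ENNReal.toReal_pos (zero_lt_one.trans_le Fact.out).ne' hp'
  let A : ℓ^p(ℕ, ℝ) →ₗ[ℝ] ℓ^p(ℕ, ℝ) :=
    { toFun := fun x => ⟨L x, memℓp_gen' (hL x)⟩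
      map_add' := fun x y => lp.ext (L.map_add x y)
      map_smul' := fun c x => lp.ext (L.map_smul c x) }
  exact ⟨A.mkContinuous C fun x =>
    lp.norm_le_of_forall_sum_le hp0 (by positivity) (hL x), fun _ _ => rfl⟩

/-- Weighted composition operators with injective symbol are bounded on `ℓ^p`. -/
theorem exists_clm_weighted_comp [Fact (1 ≤ p)] (hp' : p ≠ ∞) {σ : ℕ → ℕ}
    (hσ : Function.Injective σ) {w : ℕ → ℝ} {C : ℝ} (hw : ∀ k, |w k| ≤ C) :
    ∃ A : ℓ^p(ℕ, ℝ) →L[ℝ] ℓ^p(ℕ, ℝ), ∀ x k, A x k = w k * x (σ k) := by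
  have hp0 : 0 < p.toReal := ENNReal.toReal_pos (zero_lt_one.trans_le Fact.out).ne' hp'
  have hC : 0 ≤ C := (abs_nonneg _).trans (hw 0)
  refine exists_clm_of_sum_rpow_le hp'
    { toFun := fun x k => w k * x (σ k)
      map_add' := fun x y => funext fun k => by simp [mul_add]
      map_smul' := fun c x => funext fun k => by simp [mul_left_comm] } hC fun x s => ?_
  calc ∑ k ∈ s, ‖w k * x (σ k)‖ ^ p.toReal
      ≤ ∑ k ∈ s, C ^ p.toReal * ‖x (σ k)‖ ^ p.toReal := by
        refine Finset.sum_le_sum fun k _ => ?_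
        rw [norm_mul, Real.mul_rpow (norm_nonneg _) (norm_nonneg _)]
        gcongr
        exact hw k
    _ = C ^ p.toReal * ∑ m ∈ s.map ⟨σ, hσ⟩, ‖x m‖ ^ p.toReal := by
        rw [← Finset.mul_sum, Finset.sum_map]; rfl
    _ ≤ C ^ p.toReal * ‖x‖ ^ p.toReal := by
        gcongr
        exact lp.sum_rpow_le_norm_rpow hp0 x _
    _ = (C * ‖x‖) ^ p.toReal := (Real.mul_rpow hC (norm_nonneg _)).symm

/-- Extension by zero along an injective map is bounded on `ℓ^p`. -/
theorem exists_clm_extend [Fact (1 ≤ p)] (hp' : p ≠ ∞) {σ : ℕ → ℕ}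
    (hσ : Function.Injective σ) :
    ∃ A : ℓ^p(ℕ, ℝ) →L[ℝ] ℓ^p(ℕ, ℝ), ∀ x m, A x m = Function.extend σ x 0 m := by
  have hp0 : 0 < p.toReal := ENNReal.toReal_pos (zero_lt_one.trans_le Fact.out).ne' hp'
  refine exists_clm_of_sum_rpow_le hp'
    { toFun := fun x => Function.extend σ x 0
      map_add' := fun x y => by
        rw [lp.coeFn_add, ← Function.extend_add, add_zero]
      map_smul' := fun c x => by
        rw [lp.coeFn_smul, RingHom.id_apply, ← Function.extend_smul, smul_zero] }
    zero_le_one fun x s => ?_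
  calc ∑ m ∈ s, ‖Function.extend σ x 0 m‖ ^ p.toReal
      = ∑ k ∈ s.preimage σ hσ.injOn, ‖Function.extend σ x 0 (σ k)‖ ^ p.toReal := by
        refine (Finset.sum_preimage σ s hσ.injOn _ fun m _ hm => ?_).symm
        rw [Function.extend_apply' _ _ _ hm]
        simp [hp0.ne']
    _ = ∑ k ∈ s.preimage σ hσ.injOn, ‖x k‖ ^ p.toReal := by
        simp only [hσ.extend_apply]
    _ ≤ (1 * ‖x‖) ^ p.toReal := by
        rw [one_mul]
        exact lp.sum_rpow_le_norm_rpow hp0 x _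

theorem norm_le_of_geometric_bound [Fact (1 ≤ p)] (hp' : p ≠ ∞) {f : ℓ^p(ℕ, ℝ)} {c : ℝ}
    (h : ∀ k, |f k| ≤ c * (1 / 2) ^ k) : ‖f‖ ≤ c * 2 := by
  rw [← (lp.hasSum_single hp' f).tsum_eq]
  refine tsum_of_norm_bounded (hasSum_geometric_two.mul_left c) fun k => ?_
  rw [lp.norm_single (zero_lt_one.trans_le Fact.out : 0 < p)]
  exact h k

theorem opNorm_le_of_geometric_bound [Fact (1 ≤ p)] (hp' : p ≠ ∞)
    {R : ℓ^p(ℕ, ℝ) →L[ℝ] ℓ^p(ℕ, ℝ)} {c : ℝ} (hc : 0 ≤ c)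
    (h : ∀ k, ‖R (lp.single p k 1)‖ ≤ c * (1 / 2) ^ k) : ‖R‖ ≤ c * 2 := by
  refine R.opNorm_le_bound (by positivity) fun x => ?_
  rw [← (R.hasSum (lp.hasSum_single hp' x)).tsum_eq, mul_right_comm]
  refine tsum_of_norm_bounded (hasSum_geometric_two.mul_left (c * ‖x‖)) fun k => ?_
  have : lp.single p k (x k) = x k • (lp.single p k 1 : ℓ^p(ℕ, ℝ)) := by
    rw [← lp.single_smul]; simp
  rw [this, map_smul, norm_smul]
  calc ‖x k‖ * ‖R (lp.single p k 1)‖ ≤ ‖x‖ * (c * (1 / 2) ^ k) := by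
        gcongr
        · exact lp.norm_apply_le_norm (zero_lt_one.trans_le Fact.out).ne' x k
        · exact h k
    _ = c * ‖x‖ * (1 / 2) ^ k := by ring

/-- If infinitely many diagonal entries of an operator `H` on `ℓ^p` are at least `1 / 2` in
absolute value, then the identity of `ℓ^p` factors through `H`. -/
theorem exists_factor_of_frequently_diag [Fact (1 ≤ p)] (hp : 1 < p) (hp' : p ≠ ∞)
    (H : ℓ^p(ℕ, ℝ) →L[ℝ] ℓ^p(ℕ, ℝ))
    (hH : ∃ᶠ n in atTop, 1 / 2 ≤ |H (lp.single p n 1) n|) :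
    ∃ N M : ℓ^p(ℕ, ℝ) →L[ℝ] ℓ^p(ℕ, ℝ), ∀ x, N (H (M x)) = x := by
  obtain ⟨σ, hσ, hdiag, hoff⟩ := exists_strictMono_offDiag_le
    (a := fun m n => H (lp.single p n 1) m)
    (fun m => tendsto_clm_single_zero hp hp' (lp.evalCLM ℝ (fun _ : ℕ => ℝ) p m ∘L H))
    (fun n => tendsto_apply_zero hp' _) hH (c := 1 / 16) (by norm_num)
  have hd : ∀ k, 0 < |H (lp.single p (σ k) 1) (σ k)| := fun k =>
    one_half_pos.trans_le (hdiag k)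
  have hw : ∀ k, |(H (lp.single p (σ k) 1) (σ k))⁻¹| ≤ 2 := fun k => by
    rw [abs_inv]
    exact (inv_le_comm₀ (hd k) two_pos).2 (by simpa using hdiag k)
  obtain ⟨P, hP⟩ := exists_clm_weighted_comp hp' hσ.injective hw
  obtain ⟨J, hJ⟩ := exists_clm_extend hp' hσ.injective
  have hJs : ∀ k, J (lp.single p k 1) = lp.single p (σ k) 1 := by
    intro k
    ext m
    rw [hJ]
    by_cases hm : ∃ l, σ l = m
    · obtain ⟨l, rfl⟩ := hm
      rw [hσ.injective.extend_apply]
      simp [Pi.single_apply, hσ.injective.eq_iff]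
    · rw [Function.extend_apply' _ _ _ hm, lp.single_apply_ne _ _ _ fun h => hm ⟨k, h.symm⟩]
      rfl
  have hR : ‖1 - P ∘L H ∘L J‖ ≤ 1 / 4 * 2 := by
    refine opNorm_le_of_geometric_bound hp' (by norm_num) fun k => ?_
    refine (norm_le_of_geometric_bound (c := 1 / 8 * (1 / 2) ^ k) hp' fun j => ?_).trans_eq
      (by ring)
    have hent : ((1 - P ∘L H ∘L J) (lp.single p k 1)) j =
        (Pi.single k 1 : ℕ → ℝ) j -
          (H (lp.single p (σ j) 1) (σ j))⁻¹ * H (lp.single p (σ k) 1) (σ j) := by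
      rw [← hJs k, ← hP]; rfl
    rw [hent]
    rcases eq_or_ne j k with rfl | hjk
    · rw [inv_mul_cancel₀ (abs_pos.1 (hd j)), Pi.single_eq_same, sub_self, abs_zero]
      positivity
    · rw [Pi.single_eq_of_ne hjk, zero_sub, abs_neg, abs_mul]
      exact (mul_le_mul (hw j) (hoff j k hjk) (abs_nonneg _) zero_le_two).trans_eq (by ring)
  have hunit : IsUnit (P ∘L H ∘L J) := by
    have := isUnit_one_sub_of_norm_lt_one (hR.trans_lt (by norm_num))
    rwa [sub_sub_cancel] at this
  obtain ⟨B, hB⟩ := hunit.exists_left_inv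
  exact ⟨B ∘L P, J, fun x => congrArg (fun A : ℓ^p(ℕ, ℝ) →L[ℝ] ℓ^p(ℕ, ℝ) => A x) hB⟩

end lp

/-- **"Consequently" part of Theorem 1.1 at `ℓ^q`, `1 < q < ∞`.**  For every bounded linear
operator `T` on `ℓ^q` there is `H ∈ {T, Id − T}` such that `H(ℓ^q)` contains a closed subspace
`Y` which is isomorphic to `ℓ^q` and complemented in `ℓ^q`. -/
theorem lq_contains_complemented_copy
    (q : ℝ≥0∞) [Fact (1 ≤ q)] (hq : 1 < q) (hq' : q < ∞)
    (T : lp (fun _ : ℕ => ℝ) q →L[ℝ] lp (fun _ : ℕ => ℝ) q) :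
    ∃ H : lp (fun _ : ℕ => ℝ) q →L[ℝ] lp (fun _ : ℕ => ℝ) q,
      (H = T ∨ H = ContinuousLinearMap.id ℝ (lp (fun _ : ℕ => ℝ) q) - T) ∧
      ∃ Y : Submodule ℝ (lp (fun _ : ℕ => ℝ) q),
        IsClosed (Y : Set (lp (fun _ : ℕ => ℝ) q)) ∧
        (Y : Set (lp (fun _ : ℕ => ℝ) q)) ⊆ Set.range H ∧
        Nonempty (Y ≃L[ℝ] lp (fun _ : ℕ => ℝ) q) ∧
        ∃ Q : lp (fun _ : ℕ => ℝ) q →L[ℝ] lp (fun _ : ℕ => ℝ) q,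
          (∀ z, Q z ∈ Y) ∧ (∀ y ∈ Y, Q y = y) := by
  obtain ⟨H, hHT, hH⟩ : ∃ H : lp (fun _ : ℕ => ℝ) q →L[ℝ] lp (fun _ : ℕ => ℝ) q,
      (H = T ∨ H = ContinuousLinearMap.id ℝ (lp (fun _ : ℕ => ℝ) q) - T) ∧
      ∃ᶠ n in atTop, 1 / 2 ≤ |H (lp.single q n 1) n| := by
    have hor : ∃ᶠ n in atTop, 1 / 2 ≤ |T (lp.single q n 1) n| ∨
        1 / 2 ≤ |(ContinuousLinearMap.id ℝ (lp (fun _ : ℕ => ℝ) q) - T) (lp.single q n 1) n| := by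
      refine Frequently.of_forall fun n => ?_
      have hsub : (ContinuousLinearMap.id ℝ (lp (fun _ : ℕ => ℝ) q) - T) (lp.single q n 1) n =
          1 - T (lp.single q n 1) n :=
        congrArg (· - T (lp.single q n 1) n) (lp.single_apply_self (E := fun _ : ℕ => ℝ) q n 1)
      rw [hsub]
      by_contra! h
      linarith [abs_lt.1 h.1, abs_lt.1 h.2]
    rcases frequently_or_distrib.1 hor with h | h
    exacts [⟨_, Or.inl rfl, h⟩, ⟨_, Or.inr rfl, h⟩]
  obtain ⟨N, M, hNM⟩ := lp.exists_factor_of_frequently_diag hq hq'.ne H hH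
  exact ⟨H, hHT, exists_complemented_copy_of_factor N H M hNM⟩
end

section
/- Let 1 ≤ p ≤ ∞ and 1 < q < ∞, and let Z = ℓ^p(ℓ^q) denote the ℓ^p-sum of countably many copies of ℓ^q. For every bounded linear operator T : Z → Z there exist bounded linear operators M, N : Z → Z with ‖M‖·‖N‖ ≤ 48 such that either N ∘ T ∘ M = Id or N ∘ (Id − T) ∘ M = Id, where Id denotes the identity operator on Z. -/
open scoped ENNReal
open Filter Topology

theorem hasSum_one_half_pow_succ : HasSum (fun n : ℕ => ((1 : ℝ) / 2) ^ (n + 1)) 1 := by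
  simpa [pow_succ, div_eq_mul_inv, mul_comm] using hasSum_geometric_two' 1

section Operators

variable {ι κ E F : Type*} [NormedAddCommGroup E] [NormedAddCommGroup F] {p : ℝ≥0∞}
  [hp : Fact (1 ≤ p)]

theorem memℓp_of_forall_norm_le_comp (x : lp (fun _ : ι => E) p) (y : κ → F) (S : Set κ) (φ : κ → ι)
    (hφ : S.InjOn φ) {C : ℝ} (hC : 0 ≤ C) (hy : ∀ i ∈ S, ‖y i‖ ≤ C * ‖x (φ i)‖)
    (hy0 : ∀ i ∉ S, y i = 0) :
    ∃ h : Memℓp y p, ‖(⟨y, h⟩ : lp (fun _ : κ => F) p)‖ ≤ C * ‖x‖ := by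
  classical
  have hp0 : p ≠ 0 := (zero_lt_one.trans_le hp.out).ne'
  rcases eq_or_ne p ∞ with rfl | hp'
  · have hb : ∀ i, ‖y i‖ ≤ C * ‖x‖ := fun i => by
      by_cases hi : i ∈ S
      · exact (hy i hi).trans (by gcongr; exact lp.norm_apply_le_norm hp0 x _)
      · rw [hy0 i hi, norm_zero]; positivity
    refine ⟨memℓp_infty ⟨C * ‖x‖, ?_⟩, lp.norm_le_of_forall_le (by positivity) hb⟩
    rintro _ ⟨i, rfl⟩
    exact hb i
  · have hr : 0 < p.toReal := ENNReal.toReal_pos hp0 hp'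
    have hb : ∀ s : Finset κ, ∑ i ∈ s, ‖y i‖ ^ p.toReal ≤ (C * ‖x‖) ^ p.toReal := fun s => by
      calc ∑ i ∈ s, ‖y i‖ ^ p.toReal
          = ∑ i ∈ s with i ∈ S, ‖y i‖ ^ p.toReal := by
            refine (Finset.sum_filter_of_ne fun i _ h => ?_).symm
            by_contra hi
            exact h (by rw [hy0 i hi, norm_zero, Real.zero_rpow hr.ne'])
        _ ≤ ∑ i ∈ s with i ∈ S, C ^ p.toReal * ‖x (φ i)‖ ^ p.toReal := by
            refine Finset.sum_le_sum fun i hi => ?_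
            rw [← Real.mul_rpow hC (norm_nonneg _)]
            exact Real.rpow_le_rpow (norm_nonneg _) (hy i (Finset.mem_filter.1 hi).2) hr.le
        _ = C ^ p.toReal * ∑ j ∈ ({i ∈ s | i ∈ S}).image φ, ‖x j‖ ^ p.toReal := by
            rw [Finset.sum_image, Finset.mul_sum]
            exact fun i hi j hj h => hφ (by simp_all) (by simp_all) h
        _ ≤ (C * ‖x‖) ^ p.toReal := by
            rw [Real.mul_rpow hC (norm_nonneg _)]
            gcongr
            exact lp.sum_rpow_le_norm_rpow hr x _
    exact ⟨memℓp_gen' hb, lp.norm_le_of_forall_sum_le hr (by positivity) hb⟩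

/-- An element of `ℓ^p` whose coordinates are dominated by a geometric sequence. -/
theorem lp_norm_le_of_geometric (u : lp (fun _ : ℕ => E) p) {b : ℝ} (hb : 0 ≤ b)
    (hu : ∀ i, ‖u i‖ ≤ b * (1 / 2) ^ (i + 1)) : ‖u‖ ≤ b := by
  have hp0 : p ≠ 0 := (zero_lt_one.trans_le hp.out).ne'
  have hw : ∀ i : ℕ, ((1 : ℝ) / 2) ^ (i + 1) ≤ 1 := fun i =>
    pow_le_one₀ (by norm_num) (by norm_num)
  rcases eq_or_ne p ∞ with rfl | hp'
  · exact lp.norm_le_of_forall_le hb fun i => (hu i).trans (mul_le_of_le_one_right hb (hw i))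
  · have hr : 0 < p.toReal := ENNReal.toReal_pos hp0 hp'
    have hr1 : 1 ≤ p.toReal := by simpa using ENNReal.toReal_mono hp' hp.out
    refine lp.norm_le_of_forall_sum_le hr hb fun s => ?_
    calc ∑ i ∈ s, ‖u i‖ ^ p.toReal
        ≤ ∑ i ∈ s, b ^ p.toReal * (1 / 2) ^ (i + 1) := by
          refine Finset.sum_le_sum fun i _ => ?_
          refine (Real.rpow_le_rpow (norm_nonneg _) (hu i) hr.le).trans ?_
          rw [Real.mul_rpow hb (by positivity)]
          gcongr
          exact Real.rpow_le_self_of_le_one (by positivity) (hw i) hr1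
      _ = b ^ p.toReal * ∑ i ∈ s, (1 / 2) ^ (i + 1) := by rw [Finset.mul_sum]
      _ ≤ b ^ p.toReal := by
          refine mul_le_of_le_one_right (by positivity) ?_
          exact sum_le_hasSum s (fun i _ => by positivity) hasSum_one_half_pow_succ

variable [NormedSpace ℝ E] [NormedSpace ℝ F]

theorem exists_clm_of_forall_norm_le_comp (L : lp (fun _ : ι => E) p →ₗ[ℝ] (κ → F)) (S : Set κ)
    (φ : κ → ι) (hφ : S.InjOn φ) {C : ℝ} (hC : 0 ≤ C)
    (hL : ∀ x, ∀ i ∈ S, ‖L x i‖ ≤ C * ‖x (φ i)‖) (hL0 : ∀ x, ∀ i ∉ S, L x i = 0) :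
    ∃ A : lp (fun _ : ι => E) p →L[ℝ] lp (fun _ : κ => F) p, ‖A‖ ≤ C ∧ ∀ x i, A x i = L x i := by
  have H := fun x => memℓp_of_forall_norm_le_comp x (L x) S φ hφ hC (hL x) (hL0 x)
  let A₀ : lp (fun _ : ι => E) p →ₗ[ℝ] lp (fun _ : κ => F) p :=
    { toFun := fun x => ⟨L x, (H x).1⟩
      map_add' := fun x y => Subtype.ext (map_add L x y)
      map_smul' := fun c x => Subtype.ext (map_smul L c x) }
  exact ⟨A₀.mkContinuous C fun x => (H x).2, LinearMap.mkContinuous_norm_le _ hC _,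
    fun x i => rfl⟩

/-- Extension by zero along an injective map of the index sets. -/
theorem exists_clm_extend (r : ι → κ) (hr : r.Injective) :
    ∃ A : lp (fun _ : ι => E) p →L[ℝ] lp (fun _ : κ => E) p, ‖A‖ ≤ 1 ∧
      (∀ x i, A x (r i) = x i) ∧ ∀ x, ∀ k ∉ Set.range r, A x k = 0 := by
  classical
  let L : lp (fun _ : ι => E) p →ₗ[ℝ] (κ → E) :=
    { toFun := fun x => Function.extend r x 0
      map_add' := fun x y => by rw [lp.coeFn_add, ← Function.extend_add, add_zero]
      map_smul' := fun c x => by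
        rw [lp.coeFn_smul, RingHom.id_apply, ← Function.extend_smul, smul_zero] }
  have hLr : ∀ x i, L x (r i) = x i := fun x i => hr.extend_apply _ _ _
  have hL0 : ∀ x, ∀ k ∉ Set.range r, L x k = 0 := fun x k hk =>
    Function.extend_apply' _ _ _ hk
  rcases isEmpty_or_nonempty ι with hι | hι
  · exact ⟨0, by simp, fun x i => isEmptyElim i, fun x k hk => rfl⟩
  obtain ⟨A, hA, hAL⟩ := exists_clm_of_forall_norm_le_comp L (Set.range r) (Function.invFun r)
    (by
      rintro _ ⟨i, rfl⟩ _ ⟨j, rfl⟩ h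
      rw [Function.leftInverse_invFun hr, Function.leftInverse_invFun hr] at h
      rw [h]) zero_le_one
    (by rintro x _ ⟨i, rfl⟩; rw [hLr, Function.leftInverse_invFun hr, one_mul]) hL0
  exact ⟨A, hA, fun x i => by rw [hAL, hLr], fun x k hk => by rw [hAL, hL0 x k hk]⟩

/-- Coordinatewise application of a uniformly bounded family of operators. -/
theorem exists_clm_map (A : ι → E →L[ℝ] F) {C : ℝ} (hC : 0 ≤ C) (hA : ∀ i, ‖A i‖ ≤ C) :
    ∃ B : lp (fun _ : ι => E) p →L[ℝ] lp (fun _ : ι => F) p, ‖B‖ ≤ C ∧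
      ∀ x i, B x i = A i (x i) :=
  exists_clm_of_forall_norm_le_comp
    { toFun := fun x i => A i (x i)
      map_add' := fun x y => funext fun i => map_add (A i) (x i) (y i)
      map_smul' := fun c x => funext fun i => map_smul (A i) c (x i) }
    Set.univ id (Set.injOn_id _) hC (fun x i _ => (A i).le_of_opNorm_le (hA i) (x i))
    fun _ i hi => absurd (Set.mem_univ i) hi

/-- Restriction along an injective map of the index sets, followed by a bounded multiplier. -/
theorem exists_clm_smul_comp (r : κ → ι) (hr : r.Injective) (a : κ → ℝ) {C : ℝ} (hC : 0 ≤ C)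
    (ha : ∀ i, |a i| ≤ C) :
    ∃ A : lp (fun _ : ι => E) p →L[ℝ] lp (fun _ : κ => E) p, ‖A‖ ≤ C ∧
      ∀ x i, A x i = a i • x (r i) :=
  exists_clm_of_forall_norm_le_comp
    { toFun := fun x i => a i • x (r i)
      map_add' := fun x y => funext fun i => smul_add (a i) (x (r i)) (y (r i))
      map_smul' := fun c x => funext fun i => smul_comm (a i) c (x (r i)) }
    Set.univ r hr.injOn hC
    (fun x i _ => by
      change ‖a i • x (r i)‖ ≤ _
      rw [norm_smul, Real.norm_eq_abs]
      gcongr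
      exact ha i)
    fun _ i hi => absurd (Set.mem_univ i) hi

end Operators

section Rows

variable {E : Type*} [NormedAddCommGroup E] [NormedSpace ℝ E]

/-- A bounded functional on `ℓ^∞(E)` is small on some `ℓ^∞(S'; E)` with `S'` an infinite subset of a
given infinite set. -/
theorem exists_infinite_subset_abs_le (f : lp (fun _ : ℕ => E) ∞ →L[ℝ] ℝ) {S : Set ℕ}
    (hS : S.Infinite) {δ : ℝ} (hδ : 0 < δ) :
    ∃ S' ⊆ S, S'.Infinite ∧ ∀ x : lp (fun _ : ℕ => E) ∞, (∀ i ∉ S', x i = 0) → |f x| ≤ δ * ‖x‖ := by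
  by_contra! H
  have : Infinite S := hS.to_subtype
  let e : ℕ ↪ S := Infinite.natEmbedding S
  let Q : ℕ → Set ℕ := fun a => Set.range fun b => (e (Nat.pair a b) : ℕ)
  have hQS : ∀ a, Q a ⊆ S := by
    rintro a _ ⟨b, rfl⟩
    exact (e _).2
  have hQinf : ∀ a, (Q a).Infinite := fun a => Set.infinite_range_of_injective fun b b' h =>
    (Nat.pair_eq_pair.1 (e.injective (Subtype.ext h))).2
  have hQdisj : ∀ a a' k, k ∈ Q a → k ∈ Q a' → a = a' := by
    rintro a a' _ ⟨b, rfl⟩ ⟨b', h⟩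
    exact (Nat.pair_eq_pair.1 (e.injective (Subtype.ext h))).1.symm
  have hx : ∀ a, ∃ x : lp (fun _ : ℕ => E) ∞, (∀ i ∉ Q a, x i = 0) ∧ ‖x‖ ≤ 1 ∧ δ ≤ f x := fun a => by
    obtain ⟨x, hx0, hx⟩ := H (Q a) (hQS a) (hQinf a)
    have hxpos : 0 < ‖x‖ := by
      rw [norm_pos_iff]
      rintro rfl
      simp at hx
    refine ⟨((SignType.sign (f x) : ℝ) * ‖x‖⁻¹) • x, fun i hi => ?_, ?_, ?_⟩
    · rw [lp.coeFn_smul, Pi.smul_apply, hx0 i hi, smul_zero]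
    · rw [norm_smul, norm_mul, norm_inv, norm_norm, mul_assoc, inv_mul_cancel₀ hxpos.ne', mul_one]
      rcases lt_trichotomy (f x) 0 with h | h | h <;> simp [h]
    · rw [map_smul, smul_eq_mul, mul_right_comm, sign_mul_self, ← div_eq_mul_inv, le_div_iff₀ hxpos]
      exact hx.le
  choose x hx0 hx1 hxf using hx
  obtain ⟨m, hm⟩ := exists_nat_gt (‖f‖ / δ)
  have hnorm : ‖∑ a ∈ Finset.range m, x a‖ ≤ 1 := by
    refine lp.norm_le_of_forall_le zero_le_one fun k => ?_
    rw [lp.coeFn_sum, Finset.sum_apply]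
    by_cases hk : ∃ a ∈ Finset.range m, k ∈ Q a
    · obtain ⟨a, ha, hka⟩ := hk
      rw [Finset.sum_eq_single_of_mem a ha fun b _ hb =>
        hx0 b k fun hkb => hb (hQdisj _ _ _ hkb hka)]
      exact (lp.norm_apply_le_norm ENNReal.top_ne_zero _ _).trans (hx1 a)
    · push Not at hk
      rw [Finset.sum_eq_zero fun a ha => hx0 a k (hk a ha), norm_zero]
      exact zero_le_one
  have h1 : m * δ ≤ f (∑ a ∈ Finset.range m, x a) := by
    rw [map_sum]
    simpa using Finset.card_nsmul_le_sum (Finset.range m) (fun a => f (x a)) δ fun a _ => hxf a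
  have h2 : f (∑ a ∈ Finset.range m, x a) ≤ ‖f‖ := by
    refine (le_abs_self _).trans ((f.le_opNorm _).trans ?_)
    exact mul_le_of_le_one_right (norm_nonneg _) hnorm
  rw [div_lt_iff₀ hδ] at hm
  linarith

theorem exists_strictMono_hasSum_top (f : ℕ → lp (fun _ : ℕ => E) ∞ →L[ℝ] ℝ) {S : Set ℕ}
    (hS : S.Infinite) :
    ∃ r : ℕ → ℕ, StrictMono r ∧ (∀ i, r i ∈ S) ∧ ∀ n, ∀ x : lp (fun _ : ℕ => E) ∞,
      (∀ k ∉ Set.range r, x k = 0) → HasSum (fun k => f n (lp.single ∞ k (x k))) (f n x) := by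
  have hstep : ∀ (m : ℕ) (A : {A : Set ℕ // A.Infinite}), ∃ A' : {A : Set ℕ // A.Infinite},
      A'.1 ⊆ A.1 ∧ ∀ x : lp (fun _ : ℕ => E) ∞, (∀ i ∉ A'.1, x i = 0) →
        |f m.unpair.1 x| ≤ 1 / ((m.unpair.2 : ℝ) + 1) * ‖x‖ := fun m A => by
    obtain ⟨S', h1, h2, h3⟩ := exists_infinite_subset_abs_le (f m.unpair.1) A.2
      (Nat.one_div_pos_of_nat (α := ℝ) (n := m.unpair.2))
    exact ⟨⟨S', h2⟩, h1, h3⟩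
  choose g hg1 hg2 using hstep
  let A : ℕ → {A : Set ℕ // A.Infinite} := fun m => Nat.rec ⟨S, hS⟩ g m
  have hA : Antitone fun m => (A m).1 := antitone_nat_of_succ_le fun m => hg1 m (A m)
  obtain ⟨r, hr, hrA⟩ := extraction_forall_of_frequently
    fun m => Nat.frequently_atTop_iff_infinite.2 (A m).2
  refine ⟨r, hr, fun i => hA (Nat.zero_le i) (hrA i), fun n x hx => ?_⟩
  rw [HasSum, SummationFilter.unconditional_filter, Metric.tendsto_atTop]
  intro ε hε
  obtain ⟨d, hd⟩ := exists_nat_one_div_lt (show 0 < ε / (‖x‖ + 1) by positivity)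
  refine ⟨Finset.range (r (Nat.pair n d + 1)), fun s hs => ?_⟩
  let y : lp (fun _ : ℕ => E) ∞ := x - ∑ k ∈ s, lp.single ∞ k (x k)
  have hyk : ∀ k, y k = if k ∈ s then 0 else x k := fun k => by
    simp only [y, lp.coeFn_sub, Pi.sub_apply, lp.coeFn_sum, Finset.sum_apply, lp.single_apply,
      Finset.sum_pi_single]
    split_ifs <;> simp
  have hy0 : ∀ k ∉ (A (Nat.pair n d + 1)).1, y k = 0 := fun k hk => by
    rw [hyk]
    split_ifs with hks
    · rfl
    · refine hx k ?_
      rintro ⟨i, rfl⟩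
      refine hk (hA (?_ : Nat.pair n d + 1 ≤ i) (hrA i))
      by_contra! hi
      exact hks (hs (Finset.mem_range.2 (hr hi)))
  have hyn : ‖y‖ ≤ ‖x‖ := lp.norm_mono ENNReal.top_ne_zero fun k => by
    rw [hyk]
    split_ifs <;> simp
  have h := hg2 (Nat.pair n d) (A (Nat.pair n d)) y hy0
  rw [Nat.unpair_pair] at h
  have hfy : f n x - ∑ k ∈ s, f n (lp.single ∞ k (x k)) = f n y := by
    simp only [y, map_sub, map_sum]
  rw [dist_comm, Real.dist_eq, hfy]
  calc |f n y| ≤ 1 / ((d : ℝ) + 1) * ‖y‖ := h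
    _ ≤ 1 / ((d : ℝ) + 1) * ‖x‖ := by gcongr
    _ ≤ ε / (‖x‖ + 1) * ‖x‖ := by gcongr
    _ < ε := by
      rw [div_mul_eq_mul_div, div_lt_iff₀ (by positivity)]
      nlinarith [norm_nonneg x]

/-- Given countably many bounded functionals on `ℓ^p(E)`, any infinite set of indices has an infinite
subset such that each functional is determined by its values on single coordinates for elements
supported on that subset. -/
theorem exists_strictMono_hasSum {p : ℝ≥0∞} [Fact (1 ≤ p)] (f : ℕ → lp (fun _ : ℕ => E) p →L[ℝ] ℝ)
    {S : Set ℕ} (hS : S.Infinite) :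
    ∃ r : ℕ → ℕ, StrictMono r ∧ (∀ i, r i ∈ S) ∧ ∀ n, ∀ x : lp (fun _ : ℕ => E) p,
      (∀ k ∉ Set.range r, x k = 0) → HasSum (fun k => f n (lp.single p k (x k))) (f n x) := by
  rcases eq_or_ne p ∞ with rfl | hp
  · exact exists_strictMono_hasSum_top f hS
  · obtain ⟨r, hr, hrS⟩ := extraction_of_frequently_atTop
      (Nat.frequently_atTop_iff_infinite.2 hS)
    exact ⟨r, hr, hrS, fun n x _ => (f n).hasSum (lp.hasSum_single hp x)⟩

end Rows

section Columns

variable {q : ℝ≥0∞} [hq1 : Fact (1 ≤ q)]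

theorem tendsto_lp_apply_atTop (hq : q < ∞) (x : lp (fun _ : ℕ => ℝ) q) :
    Tendsto (fun j => x j) atTop (𝓝 0) := by
  have hr : 0 < q.toReal := ENNReal.toReal_pos (zero_lt_one.trans_le hq1.out).ne' hq.ne
  have h := ((lp.memℓp x).summable hr).tendsto_atTop_zero
  have h2 := h.rpow_const (p := q.toReal⁻¹) (Or.inr (by positivity))
  rw [Real.zero_rpow (by positivity)] at h2
  rw [tendsto_zero_iff_norm_tendsto_zero]
  refine h2.congr fun j => ?_
  rw [← Real.rpow_mul (norm_nonneg _), mul_inv_cancel₀ hr.ne', Real.rpow_one]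

theorem tendsto_apply_single_atTop (hq : 1 < q) (hq' : q < ∞) (φ : lp (fun _ : ℕ => ℝ) q →L[ℝ] ℝ) :
    Tendsto (fun j => φ (lp.single q j 1)) atTop (𝓝 0) := by
  have hr1 : 1 < q.toReal := by
    simpa using (ENNReal.toReal_lt_toReal ENNReal.one_ne_top hq'.ne).2 hq
  have hr : 0 < q.toReal := zero_lt_one.trans hr1
  rw [Metric.tendsto_atTop']
  by_contra! H
  obtain ⟨δ, hδ, H⟩ := H
  have hfr : ∃ᶠ j in atTop, δ ≤ |φ (lp.single q j 1)| := by
    rw [frequently_atTop']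
    intro a
    obtain ⟨b, hb, h⟩ := H a
    exact ⟨b, hb, by simpa [Real.dist_eq] using h⟩
  have hinf := Nat.frequently_atTop_iff_infinite.1 hfr
  have hbound : ∀ m : ℕ, 0 < m → (m : ℝ) ^ (q.toReal - 1) ≤ (‖φ‖ / δ) ^ q.toReal := fun m hm => by
    obtain ⟨s, hsub, hcard⟩ := hinf.exists_subset_card_eq m
    have hm0 : (0 : ℝ) < m := Nat.cast_pos.2 hm
    let a : ℕ → ℝ := fun j => SignType.sign (φ (lp.single q j 1))
    have ha : ∀ j, ‖a j‖ ≤ 1 := fun j => by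
      rcases lt_trichotomy (φ (lp.single q j 1)) 0 with h | h | h <;> simp [a, h]
    let x : lp (fun _ : ℕ => ℝ) q := ∑ j ∈ s, lp.single q j (a j)
    have hx : ‖x‖ ^ q.toReal ≤ m := by
      rw [lp.norm_sum_single hr]
      refine (Finset.sum_le_card_nsmul s _ 1 fun j _ =>
        Real.rpow_le_one (norm_nonneg _) (ha j) hr.le).trans ?_
      simp [hcard]
    have hφx : m * δ ≤ φ x := by
      have h1 : φ x = ∑ j ∈ s, |φ (lp.single q j 1)| := by
        rw [map_sum]
        refine Finset.sum_congr rfl fun j _ => ?_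
        rw [← sign_mul_self, ← smul_eq_mul, ← map_smul, ← lp.single_smul, smul_eq_mul, mul_one]
      rw [h1]
      have := Finset.card_nsmul_le_sum s (fun j => |φ (lp.single q j 1)|) δ
        fun j hj => hsub (Finset.mem_coe.2 hj)
      simpa [hcard] using this
    have h2 : (m : ℝ) ≤ ‖φ‖ / δ * ‖x‖ := by
      rw [div_mul_eq_mul_div, le_div_iff₀ hδ]
      exact hφx.trans ((le_abs_self _).trans (φ.le_opNorm x))
    have h3 : (m : ℝ) ^ q.toReal ≤ (‖φ‖ / δ) ^ q.toReal * m := by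
      refine (Real.rpow_le_rpow hm0.le h2 hr.le).trans ?_
      rw [Real.mul_rpow (by positivity) (norm_nonneg _)]
      gcongr
    rwa [Real.rpow_sub_one hm0.ne', div_le_iff₀ hm0]
  have ht : Tendsto (fun m : ℕ => (m : ℝ) ^ (q.toReal - 1)) atTop atTop :=
    (tendsto_rpow_atTop (by linarith)).comp tendsto_natCast_atTop_atTop
  obtain ⟨m, hm, hm0⟩ := ((ht.eventually_gt_atTop ((‖φ‖ / δ) ^ q.toReal)).and
    (eventually_gt_atTop 0)).exists
  exact absurd (hbound m hm0) (not_le.2 hm)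

end Columns

theorem exists_strictMono_of_frequently_eventually (P : ℕ → ℕ → Prop) (R : ℕ → ℕ → ℕ → ℕ → Prop)
    (hP : ∀ n, ∃ᶠ b in atTop, P n b) (hR : ∀ m n a, m < n → ∀ᶠ b in atTop, R m a n b) :
    ∃ c : ℕ → ℕ, StrictMono c ∧ (∀ n, P n (c n)) ∧ ∀ m n, m < n → R m (c m) n (c n) := by
  have hstep : ∀ n A, ∃ b, P n b ∧ A < b ∧ ∀ m < n, ∀ a ≤ A, R m a n b := fun n A => by
    have h : ∀ᶠ b in atTop, ∀ m < n, ∀ a ≤ A, R m a n b := by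
      refine ((Set.finite_lt_nat n).eventually_all).2 fun m hm => ?_
      exact ((Set.finite_le_nat A).eventually_all).2 fun a _ => hR m n a hm
    obtain ⟨b, h1, h2, h3⟩ := ((hP n).and_eventually ((eventually_gt_atTop A).and h)).exists
    exact ⟨b, h1, h2, h3⟩
  choose g hgP hgA hgR using hstep
  let c : ℕ → ℕ := fun n => Nat.rec (g 0 0) (fun n b => g (n + 1) b) n
  have hc : StrictMono c := strictMono_nat_of_lt_succ fun n => hgA (n + 1) (c n)
  refine ⟨c, hc, fun n => ?_, fun m n hmn => ?_⟩
  · cases n with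
    | zero => exact hgP 0 0
    | succ n => exact hgP (n + 1) (c n)
  · cases n with
    | zero => exact absurd hmn (Nat.not_lt_zero m)
    | succ n => exact hgR (n + 1) (c n) m hmn (c m) (hc.monotone (Nat.lt_succ_iff.1 hmn))

section Factorization

variable {p q : ℝ≥0∞} [hp1 : Fact (1 ≤ p)] [hq1 : Fact (1 ≤ q)]

theorem abs_apply_le_of_hasSum (hq' : q < ∞)
    (g : lp (fun _ : ℕ => lp (fun _ : ℕ => ℝ) q) p →L[ℝ] ℝ)
    (hg : ∀ x, HasSum (fun i => g (lp.single p i (x i))) (g x)) {a : ℝ}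
    (hga : ∀ i j, |g (lp.single p i (lp.single q j 1))| ≤ a * ((1 / 2) ^ (i + 1) * (1 / 2) ^ (j + 1)))
    (x : lp (fun _ : ℕ => lp (fun _ : ℕ => ℝ) q) p) : |g x| ≤ a * ‖x‖ := by
  have hp0 : p ≠ 0 := (zero_lt_one.trans_le hp1.out).ne'
  have hq0 : q ≠ 0 := (zero_lt_one.trans_le hq1.out).ne'
  have hrow : ∀ i, |g (lp.single p i (x i))| ≤ a * ‖x‖ * (1 / 2) ^ (i + 1) := fun i => by
    let ψ : lp (fun _ : ℕ => ℝ) q →L[ℝ] ℝ := 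
      g ∘L lp.singleContinuousLinearMap ℝ (fun _ : ℕ => lp (fun _ : ℕ => ℝ) q) p i
    have h : HasSum (fun j => ψ (lp.single q j (x i j))) (ψ (x i)) :=
      ψ.hasSum (lp.hasSum_single hq'.ne (x i))
    have hb := hasSum_one_half_pow_succ.mul_left (a * ‖x‖ * (1 / 2) ^ (i + 1))
    rw [mul_one] at hb
    refine h.norm_le_of_bounded hb fun j => ?_
    have hj : ψ (lp.single q j (x i j)) = x i j * g (lp.single p i (lp.single q j 1)) := by
      have : lp.single q j (x i j) = (x i j) • (lp.single q j (1 : ℝ) : lp (fun _ : ℕ => ℝ) q) := by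
        rw [← lp.single_smul, smul_eq_mul, mul_one]
      rw [this, map_smul]
      rfl
    rw [hj, norm_mul]
    have hx : ‖x i j‖ ≤ ‖x‖ :=
      (lp.norm_apply_le_norm hq0 (x i) j).trans (lp.norm_apply_le_norm hp0 x i)
    calc ‖x i j‖ * |g (lp.single p i (lp.single q j 1))|
        ≤ ‖x‖ * (a * ((1 / 2) ^ (i + 1) * (1 / 2) ^ (j + 1))) := by
          gcongr
          exact hga i j
      _ = a * ‖x‖ * (1 / 2) ^ (i + 1) * (1 / 2) ^ (j + 1) := by ring
  have hb := hasSum_one_half_pow_succ.mul_left (a * ‖x‖)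
  rw [mul_one] at hb
  exact (hg x).norm_le_of_bounded hb hrow

/-- Columns can be selected so that the matrix of `T` restricted to them has large diagonal and small
off-diagonal entries. -/
theorem exists_columns_of_diagonal (hq : 1 < q) (hq' : q < ∞)
    (T : lp (fun _ : ℕ => lp (fun _ : ℕ => ℝ) q) p →L[ℝ] lp (fun _ : ℕ => lp (fun _ : ℕ => ℝ) q) p)
    (hdiag : ∀ k, ∃ᶠ l in atTop, 1 / 2 ≤ |T (lp.single p k (lp.single q l 1)) k l|) :
    ∃ γ : ℕ → ℕ → ℕ, (∀ i, (γ i).Injective) ∧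
      (∀ i j, 1 / 2 ≤ |T (lp.single p i (lp.single q (γ i j) 1)) i (γ i j)|) ∧
      ∀ i j i' j', (i', j') ≠ (i, j) → |T (lp.single p i' (lp.single q (γ i' j') 1)) i (γ i j)| ≤
        1 / 4 * (((1 / 2) ^ (i + 1) * (1 / 2) ^ (j + 1)) *
          ((1 / 2) ^ (i' + 1) * (1 / 2) ^ (j' + 1))) := by
  let t : ℕ → ℕ → ℕ → ℕ → ℝ := fun k l k' l' => T (lp.single p k' (lp.single q l' 1)) k l
  let w : ℕ → ℝ := fun n => (1 / 2) ^ (n.unpair.1 + 1) * (1 / 2) ^ (n.unpair.2 + 1)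
  have hcol : ∀ k l k', Tendsto (fun l' => t k l k' l') atTop (𝓝 0) := fun k l k' =>
    tendsto_apply_single_atTop hq hq' (lp.evalCLM ℝ (fun _ : ℕ => ℝ) q l ∘L
      lp.evalCLM ℝ (fun _ : ℕ => lp (fun _ : ℕ => ℝ) q) p k ∘L T ∘L
      lp.singleContinuousLinearMap ℝ (fun _ : ℕ => lp (fun _ : ℕ => ℝ) q) p k')
  have hrow : ∀ k k' l', Tendsto (fun l => t k l k' l') atTop (𝓝 0) := fun k k' l' =>
    tendsto_lp_apply_atTop hq' _
  have hev : ∀ {u : ℕ → ℝ}, Tendsto u atTop (𝓝 0) → ∀ m n, ∀ᶠ b in atTop,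
      |u b| ≤ 1 / 4 * (w m * w n) := fun hu m n => by
    have := hu.abs
    rw [abs_zero] at this
    exact this.eventually_le_const (by positivity)
  obtain ⟨c, hc, hcP, hcR⟩ := exists_strictMono_of_frequently_eventually
    (fun n b => 1 / 2 ≤ |t n.unpair.1 b n.unpair.1 b|)
    (fun m a n b => |t m.unpair.1 a n.unpair.1 b| ≤ 1 / 4 * (w m * w n) ∧
      |t n.unpair.1 b m.unpair.1 a| ≤ 1 / 4 * (w n * w m))
    (fun n => hdiag _) fun m n a _ =>
      (hev (hcol _ _ _) m n).and (hev (hrow _ _ _) n m)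
  have hoff : ∀ m n, n ≠ m → |t m.unpair.1 (c m) n.unpair.1 (c n)| ≤ 1 / 4 * (w m * w n) :=
    fun m n hmn => by
      rcases lt_or_gt_of_ne hmn with h | h
      · exact (hcR n m h).2
      · exact (hcR m n h).1
  refine ⟨fun i j => c (Nat.pair i j), fun i j j' h => (Nat.pair_eq_pair.1 (hc.injective h)).2,
    fun i j => by simpa [t] using hcP (Nat.pair i j), fun i j i' j' h => ?_⟩
  have := hoff (Nat.pair i j) (Nat.pair i' j') fun h' => h (by simpa [Nat.pair_eq_pair] using h')
  simpa only [t, w, Nat.unpair_pair] using this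

theorem exists_left_inverse_of_norm_sub_le {Z : Type*} [NormedAddCommGroup Z] [NormedSpace ℝ Z]
    [CompleteSpace Z] (B : Z →L[ℝ] Z) (hB : ∀ x, ‖B x - x‖ ≤ 1 / 2 * ‖x‖) :
    ∃ B' : Z →L[ℝ] Z, ‖B'‖ ≤ 2 ∧ B' ∘L B = ContinuousLinearMap.id ℝ Z := by
  have h1 : ‖1 - B‖ ≤ 1 / 2 := ContinuousLinearMap.opNorm_le_bound _ (by norm_num) fun x => by
    rw [sub_apply, norm_sub_rev]
    exact hB x
  let U := Units.oneSub (1 - B) (h1.trans_lt (by norm_num))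
  have hU : (U : Z →L[ℝ] Z) = B := sub_sub_cancel 1 B
  have hinv : ((U⁻¹ : (Z →L[ℝ] Z)ˣ) : Z →L[ℝ] Z) * B = 1 := by rw [← hU, Units.inv_mul]
  have hinv' : B * ((U⁻¹ : (Z →L[ℝ] Z)ˣ) : Z →L[ℝ] Z) = 1 := by rw [← hU, Units.mul_inv]
  refine ⟨(U⁻¹ : (Z →L[ℝ] Z)ˣ), ContinuousLinearMap.opNorm_le_bound _ (by norm_num) fun y => ?_, hinv⟩
  set z := ((U⁻¹ : (Z →L[ℝ] Z)ˣ) : Z →L[ℝ] Z) y with hz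
  have hBz : B z = y := by
    rw [hz, ← mul_apply_eq_comp, hinv', one_apply_eq_self]
  have h2 := hB z
  have h3 : ‖z‖ ≤ ‖B z - z‖ + ‖B z‖ := by
    rw [norm_sub_rev]
    simpa using norm_add_le (z - B z) (B z)
  rw [hBz] at h2 h3
  linarith

/-- The identity factors through an operator with large diagonal entries whose coordinates are
determined by the single rows. -/
theorem exists_factorization_of_diagonal (hq : 1 < q) (hq' : q < ∞)
    (T : lp (fun _ : ℕ => lp (fun _ : ℕ => ℝ) q) p →L[ℝ] lp (fun _ : ℕ => lp (fun _ : ℕ => ℝ) q) p)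
    (hdiag : ∀ k, ∃ᶠ l in atTop, 1 / 2 ≤ |T (lp.single p k (lp.single q l 1)) k l|)
    (hsum : ∀ k l x, HasSum (fun i => T (lp.single p i (x i)) k l) (T x k l)) :
    ∃ M N : lp (fun _ : ℕ => lp (fun _ : ℕ => ℝ) q) p →L[ℝ] lp (fun _ : ℕ => lp (fun _ : ℕ => ℝ) q) p,
      ‖M‖ ≤ 1 ∧ ‖N‖ ≤ 4 ∧
        N ∘L T ∘L M = ContinuousLinearMap.id ℝ (lp (fun _ : ℕ => lp (fun _ : ℕ => ℝ) q) p) := by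
  obtain ⟨γ, hγ, hγd, hγo⟩ := exists_columns_of_diagonal hq hq' T hdiag
  let d : ℕ → ℕ → ℝ := fun i j => T (lp.single p i (lp.single q (γ i j) 1)) i (γ i j)
  have hd : ∀ i j, |(d i j)⁻¹| ≤ 2 := fun i j => by
    rw [abs_inv]
    exact (inv_anti₀ (by norm_num) (hγd i j)).trans (by norm_num)
  have hd0 : ∀ i j, d i j ≠ 0 := fun i j => abs_pos.1 (lt_of_lt_of_le (by norm_num) (hγd i j))
  choose U hU hUγ hU0 using fun i => exists_clm_extend (E := ℝ) (p := q) (γ i) (hγ i)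
  choose V hV hVγ using fun i => exists_clm_smul_comp (E := ℝ) (p := q) (γ i) (hγ i)
    (fun j => (d i j)⁻¹) zero_le_two (hd i)
  obtain ⟨M, hM, hMU⟩ := exists_clm_map (p := p) U zero_le_one hU
  obtain ⟨N, hN, hNV⟩ := exists_clm_map (p := p) V zero_le_two hV
  have hUs : ∀ i j, U i (lp.single q j 1) = lp.single q (γ i j) 1 := fun i j => by
    ext l
    by_cases hl : l ∈ Set.range (γ i)
    · obtain ⟨j', rfl⟩ := hl
      rw [hUγ, lp.single_apply, lp.single_apply, Pi.single_apply, Pi.single_apply]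
      simp only [(hγ i).eq_iff]
    · rw [hU0 i _ l hl, lp.single_apply_ne]
      rintro rfl
      exact hl ⟨j, rfl⟩
  have hMs : ∀ i u, M (lp.single p i u) = lp.single p i (U i u) := fun i u => by
    refine lp.ext (funext fun k => ?_)
    rw [hMU]
    by_cases hk : k = i
    · subst hk
      rw [lp.single_apply_self, lp.single_apply_self]
    · rw [lp.single_apply_ne _ _ _ hk, lp.single_apply_ne _ _ _ hk, map_zero]
  have hcoord : ∀ x i j, |(N (T (M x)) - x) i j| ≤
      1 / 2 * ((1 / 2) ^ (i + 1) * (1 / 2) ^ (j + 1)) * ‖x‖ := fun x i j => by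
    let g : lp (fun _ : ℕ => lp (fun _ : ℕ => ℝ) q) p →L[ℝ] ℝ :=
      lp.evalCLM ℝ _ q j ∘L lp.evalCLM ℝ _ p i ∘L (N ∘L T ∘L M - ContinuousLinearMap.id ℝ _)
    have hgx : ∀ x, g x = (d i j)⁻¹ * T (M x) i (γ i j) - x i j := fun x => by
      change (N (T (M x))) i j - x i j = _
      rw [hNV, hVγ, smul_eq_mul]
    refine abs_apply_le_of_hasSum hq' g (fun x => ?_) (fun i' j' => ?_) x
    · simp only [hgx, hMs]
      refine HasSum.sub (HasSum.mul_left _ ?_) ?_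
      · have := hsum i (γ i j) (M x)
        simpa only [hMU] using this
      · have h : HasSum (fun i' => (lp.single p i' (x i') :
            lp (fun _ : ℕ => lp (fun _ : ℕ => ℝ) q) p) i j)
            ((lp.single p i (x i) : lp (fun _ : ℕ => lp (fun _ : ℕ => ℝ) q) p) i j) :=
          hasSum_single i fun i' hi' => by
            rw [lp.single_apply_ne _ _ _ hi'.symm]
            rfl
        rwa [lp.single_apply_self] at h
    · rw [hgx, hMs, hUs]
      by_cases h : (i', j') = (i, j)
      · obtain ⟨rfl, rfl⟩ := Prod.mk.inj h
        rw [lp.single_apply_self, lp.single_apply_self, inv_mul_cancel₀ (hd0 i' j'), sub_self,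
          abs_zero]
        positivity
      · have h0 : (lp.single p i' (lp.single q j' 1) :
            lp (fun _ : ℕ => lp (fun _ : ℕ => ℝ) q) p) i j = 0 := by
          by_cases hi : i = i'
          · subst hi
            rw [lp.single_apply_self, lp.single_apply_ne]
            rintro rfl
            exact h rfl
          · rw [lp.single_apply_ne _ _ _ hi]
            rfl
        rw [h0, sub_zero, abs_mul]
        refine (mul_le_mul (hd i j) (hγo i j i' j' h) (abs_nonneg _) zero_le_two).trans_eq ?_
        ring
  have hB : ∀ x, ‖(N ∘L T ∘L M) x - x‖ ≤ 1 / 2 * ‖x‖ := fun x => by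
    refine lp_norm_le_of_geometric _ (by positivity) fun i => ?_
    refine lp_norm_le_of_geometric _ (by positivity) fun j => ?_
    refine (hcoord x i j).trans_eq ?_
    ring
  obtain ⟨B', hB', hB'B⟩ := exists_left_inverse_of_norm_sub_le _ hB
  refine ⟨M, B' ∘L N, hM, ?_, by rw [← hB'B]; rfl⟩
  calc ‖B' ∘L N‖ ≤ ‖B'‖ * ‖N‖ := ContinuousLinearMap.opNorm_comp_le _ _
    _ ≤ 2 * 2 := by gcongr
    _ = 4 := by norm_num

theorem exists_factorization_of_frequently_diagonal (hq : 1 < q) (hq' : q < ∞)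
    (T : lp (fun _ : ℕ => lp (fun _ : ℕ => ℝ) q) p →L[ℝ] lp (fun _ : ℕ => lp (fun _ : ℕ => ℝ) q) p)
    (hdiag : ∃ᶠ k in atTop, ∃ᶠ l in atTop,
      1 / 2 ≤ |T (lp.single p k (lp.single q l 1)) k l|) :
    ∃ M N : lp (fun _ : ℕ => lp (fun _ : ℕ => ℝ) q) p →L[ℝ] lp (fun _ : ℕ => lp (fun _ : ℕ => ℝ) q) p,
      ‖M‖ * ‖N‖ ≤ 4 ∧
        N ∘L T ∘L M = ContinuousLinearMap.id ℝ (lp (fun _ : ℕ => lp (fun _ : ℕ => ℝ) q) p) := by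
  obtain ⟨r, hr, hrS, hrsum⟩ := exists_strictMono_hasSum
    (fun n => lp.evalCLM ℝ _ q n.unpair.2 ∘L lp.evalCLM ℝ _ p n.unpair.1 ∘L T)
    (Nat.frequently_atTop_iff_infinite.1 hdiag)
  obtain ⟨J, hJ, hJr, hJ0⟩ := exists_clm_extend (E := lp (fun _ : ℕ => ℝ) q) (p := p) r hr.injective
  obtain ⟨Q, hQ, hQr⟩ := exists_clm_smul_comp (E := lp (fun _ : ℕ => ℝ) q) (p := p) r hr.injective
    (fun _ => 1) zero_le_one fun _ => abs_one.le
  simp only [one_smul] at hQr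
  have hJs : ∀ i u, J (lp.single p i u) = lp.single p (r i) u := fun i u => by
    refine lp.ext (funext fun k => ?_)
    by_cases hk : k ∈ Set.range r
    · obtain ⟨i', rfl⟩ := hk
      rw [hJr]
      by_cases hi : i' = i
      · subst hi
        rw [lp.single_apply_self, lp.single_apply_self]
      · rw [lp.single_apply_ne _ _ _ hi, lp.single_apply_ne _ _ _ (hr.injective.ne hi)]
    · rw [hJ0 _ k hk, lp.single_apply_ne]
      rintro rfl
      exact hk ⟨i, rfl⟩
  obtain ⟨M, N, hM, hN, h⟩ := exists_factorization_of_diagonal hq hq' (Q ∘L T ∘L J)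
    (fun k => by
      have : ∃ᶠ l in atTop, 1 / 2 ≤ |T (lp.single p (r k) (lp.single q l 1)) (r k) l| := hrS k
      simpa only [ContinuousLinearMap.comp_apply, hQr, hJs] using this)
    (fun k l x => by
      have hs := hrsum (Nat.pair (r k) l) (J x) fun i hi => hJ0 x i hi
      simp only [Nat.unpair_pair] at hs
      rw [← hr.injective.hasSum_iff] at hs
      · simp only [ContinuousLinearMap.comp_apply, hQr, hJs]
        simp only [Function.comp_def, hJr] at hs
        exact hs
      · intro i hi
        rw [hJ0 x i hi, lp.single_zero, map_zero])
  refine ⟨J ∘L M, N ∘L Q, ?_, h⟩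
  calc ‖J ∘L M‖ * ‖N ∘L Q‖ ≤ (‖J‖ * ‖M‖) * (‖N‖ * ‖Q‖) := by
        gcongr <;> exact ContinuousLinearMap.opNorm_comp_le _ _
    _ ≤ (1 * 1) * (4 * 1) := by gcongr
    _ = 4 := by norm_num

end Factorization

/-- **Theorem 1.2 instantiated at `S* = ℓ^q` (`K_u = K_s = 1`).**  For every bounded linear
operator `T` on `Z = ℓ^p(ℓ^q)` there exist bounded linear operators `M, N` on `Z` with
`‖M‖·‖N‖ ≤ 48` such that `N ∘ T ∘ M = Id` or `N ∘ (Id − T) ∘ M = Id`. -/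
theorem lp_lq_factorization
    (p : ℝ≥0∞) [Fact (1 ≤ p)] (q : ℝ≥0∞) [Fact (1 ≤ q)] (hq : 1 < q) (hq' : q < ∞)
    (T : lp (fun _ : ℕ => lp (fun _ : ℕ => ℝ) q) p →L[ℝ] lp (fun _ : ℕ => lp (fun _ : ℕ => ℝ) q) p) :
    ∃ M N : lp (fun _ : ℕ => lp (fun _ : ℕ => ℝ) q) p →L[ℝ] lp (fun _ : ℕ => lp (fun _ : ℕ => ℝ) q) p,
      ‖M‖ * ‖N‖ ≤ 48 ∧
      (N ∘L T ∘L M = ContinuousLinearMap.id ℝ (lp (fun _ : ℕ => lp (fun _ : ℕ => ℝ) q) p) ∨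
        N ∘L (ContinuousLinearMap.id ℝ (lp (fun _ : ℕ => lp (fun _ : ℕ => ℝ) q) p) - T) ∘L M =
          ContinuousLinearMap.id ℝ (lp (fun _ : ℕ => lp (fun _ : ℕ => ℝ) q) p)) := by
  have hcases : ∀ k l, 1 / 2 ≤ |T (lp.single p k (lp.single q l 1)) k l| ∨
      1 / 2 ≤ |(ContinuousLinearMap.id ℝ (lp (fun _ : ℕ => lp (fun _ : ℕ => ℝ) q) p) - T)
        (lp.single p k (lp.single q l 1)) k l| :=
    fun k l => by
      have h : (ContinuousLinearMap.id ℝ (lp (fun _ : ℕ => lp (fun _ : ℕ => ℝ) q) p) - T)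
          (lp.single p k (lp.single q l 1)) k l =
          1 - T (lp.single p k (lp.single q l 1)) k l := by
        change (lp.single p k (lp.single q l 1) :
          lp (fun _ : ℕ => lp (fun _ : ℕ => ℝ) q) p) k l -
          T (lp.single p k (lp.single q l 1)) k l = _
        rw [lp.single_apply_self, lp.single_apply_self]
      rw [h]
      by_contra! hlt
      have h1 := (abs_lt.1 hlt.1).2
      have h2 := (abs_lt.1 hlt.2).2
      linarith
  have hfreq : ∃ᶠ k in atTop,
      (∃ᶠ l in atTop, 1 / 2 ≤ |T (lp.single p k (lp.single q l 1)) k l|) ∨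
      ∃ᶠ l in atTop,
        1 / 2 ≤ |(ContinuousLinearMap.id ℝ (lp (fun _ : ℕ => lp (fun _ : ℕ => ℝ) q) p) - T)
          (lp.single p k (lp.single q l 1)) k l| :=
    Frequently.of_forall fun k =>
      frequently_or_distrib.1 (Frequently.of_forall fun l => hcases k l)
  rcases frequently_or_distrib.1 hfreq with h | h
  · obtain ⟨M, N, hMN, hid⟩ := exists_factorization_of_frequently_diagonal hq hq' T h
    exact ⟨M, N, hMN.trans (by norm_num), Or.inl hid⟩
  · obtain ⟨M, N, hMN, hid⟩ := exists_factorization_of_frequently_diagonal hq hq' _ h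
    exact ⟨M, N, hMN.trans (by norm_num), Or.inr hid⟩
end
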